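/- arXiv:math-ph/0608051 — 7 statements merged into one kernel-verified Lean document; each statement's English description precedes it below -/
import Mathlib

section
/- Let v_1, …, v_N be vectors in ℝ^n, let H(q,p) = (1/2)⟨p,p⟩ + Σ_{i=1}^N exp(⟨v_i,q⟩) on ℝ^n × ℝ^n, and let M be the N×N matrix M_{ki} = ⟨v_k, v_i⟩. If (q(t), p(t)) is a differentiable solution of Hamilton's equations q̇_j = ∂H/∂p_j, ṗ_j = −∂H/∂q_j, then the functions a_i(t) = −exp(⟨v_i, q(t)⟩) and b_i(t) = ⟨v_i, p(t)⟩ satisfy the polynomial system ȧ_k = a_k b_k and ḃ_k = Σ_{i=1}^N M_{ki} a_i for k = 1, …, N. -/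
/-- For the Hamiltonian `H(q,p) = (1/2)⟨p,p⟩ + Σ_i exp⟨v_i,q⟩`, solutions of
Hamilton's equations are transformed by the generalized Flaschka transformation
`a_i = -exp⟨v_i,q⟩`, `b_i = ⟨v_i,p⟩` into the polynomial system
`ȧ_k = a_k b_k`, `ḃ_k = Σ_i M_{ki} a_i` with `M_{ki} = ⟨v_k,v_i⟩`. -/
theorem flaschka_transform_of_hamilton
    (n N : ℕ) (v : Fin N → Fin n → ℝ)
    (H : (Fin n → ℝ) → (Fin n → ℝ) → ℝ)
    (hH : H = fun q p => (1/2) * (∑ j, p j * p j) + ∑ i, Real.exp (∑ j, v i j * q j))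
    (q p : ℝ → Fin n → ℝ)
    (ham1 : ∀ t, ∀ j : Fin n,
      HasDerivAt (fun s => q s j)
        (fderiv ℝ (fun p' => H (q t) p') (p t) (Pi.single j 1)) t)
    (ham2 : ∀ t, ∀ j : Fin n,
      HasDerivAt (fun s => p s j)
        (-(fderiv ℝ (fun q' => H q' (p t)) (q t) (Pi.single j 1))) t)
    (a b : ℝ → Fin N → ℝ)
    (ha : ∀ t k, a t k = -Real.exp (∑ j, v k j * q t j))
    (hb : ∀ t k, b t k = ∑ j, v k j * p t j) :
    ∀ t, ∀ k : Fin N,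
      HasDerivAt (fun s => a s k) (a t k * b t k) t ∧
      HasDerivAt (fun s => b s k) (∑ i, (∑ j, v k j * v i j) * a t i) t := by
  subst hH
  have e1 : ∀ t j, fderiv ℝ (fun p' : Fin n → ℝ => (1/2) * (∑ j, p' j * p' j)
      + ∑ i, Real.exp (∑ j, v i j * q t j)) (p t) (Pi.single j 1) = p t j := by
    intro t j
    have h : HasFDerivAt (fun p' : Fin n → ℝ => (1/2) * (∑ j, p' j * p' j)
      + ∑ i, Real.exp (∑ j, v i j * q t j)) _ (p t) :=
      ((HasFDerivAt.fun_sum (u := Finset.univ) (fun j _ =>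
        (hasFDerivAt_apply (𝕜 := ℝ) j (p t)).mul
          (hasFDerivAt_apply (𝕜 := ℝ) j (p t)))).const_mul (1/2 : ℝ)).add_const _
    rw [h.fderiv]
    simp [Pi.single_apply, Finset.sum_add_distrib]
    ring
  have e2 : ∀ t j, fderiv ℝ (fun q' : Fin n → ℝ => (1/2) * (∑ j, p t j * p t j)
      + ∑ i, Real.exp (∑ j, v i j * q' j)) (q t) (Pi.single j 1)
      = ∑ i, Real.exp (∑ j, v i j * q t j) * v i j := by
    intro t j
    have h : HasFDerivAt (fun q' : Fin n → ℝ => (1/2) * (∑ j, p t j * p t j)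
      + ∑ i, Real.exp (∑ j, v i j * q' j)) _ (q t) :=
      (HasFDerivAt.fun_sum (u := Finset.univ) (fun i _ =>
        (HasFDerivAt.fun_sum (u := Finset.univ) (fun j _ =>
          (hasFDerivAt_apply (𝕜 := ℝ) j (q t)).const_mul (v i j))).exp)).const_add _
    rw [h.fderiv]
    simp [Pi.single_apply]
  simp only [e1] at ham1
  simp only [e2] at ham2
  intro t k
  constructor
  · have h := (HasDerivAt.fun_sum (u := Finset.univ)
      (fun j _ => (ham1 t j).const_mul (v k j))).exp.neg
    simp only [ha, hb]
    refine HasDerivAt.congr_deriv h ?_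
    ring
  · have h := HasDerivAt.fun_sum (u := Finset.univ)
      (fun j _ => (ham2 t j).const_mul (v k j))
    simp only [ha, hb]
    refine HasDerivAt.congr_deriv h ?_
    simp only [Finset.sum_mul, Finset.mul_sum, mul_neg, Finset.sum_neg_distrib]
    rw [Finset.sum_comm]
    congr 1
    refine Finset.sum_congr rfl fun j _ => Finset.sum_congr rfl fun i _ => ?_
    ring
end

section
/- Let v_1, …, v_N be vectors in ℝ^n, M_{ki} = ⟨v_k, v_i⟩, and suppose λ_1, …, λ_N are real numbers with Σ_{i=1}^N λ_i v_i = 0. If (a(t), b(t)) is a differentiable solution of the system ȧ_k = a_k b_k, ḃ_k = Σ_{i=1}^N M_{ki} a_i (k = 1, …, N), then the function F_1(t) = Σ_{i=1}^N λ_i b_i(t) is constant in t. -/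
/-- If `Σ_i λ_i v_i = 0`, then `F₁ = Σ_i λ_i b_i` is a constant of motion of the
system `ȧ_k = a_k b_k`, `ḃ_k = Σ_i M_{ki} a_i` where `M_{ki} = ⟨v_k, v_i⟩`. -/
theorem F1_constant
    (n N : ℕ) (v : Fin N → Fin n → ℝ) (lam : Fin N → ℝ)
    (hlam : ∀ j : Fin n, ∑ i, lam i * v i j = 0)
    (a b : ℝ → Fin N → ℝ)
    (hsys : ∀ t, ∀ k : Fin N,
      HasDerivAt (fun s => a s k) (a t k * b t k) t ∧
      HasDerivAt (fun s => b s k) (∑ i, (∑ j, v k j * v i j) * a t i) t) :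
    ∀ t t' : ℝ, ∑ i, lam i * b t i = ∑ i, lam i * b t' i := by
  have key : ∀ t, ∑ k, lam k * (∑ i, (∑ j, v k j * v i j) * a t i) = 0 := by
    intro t
    have h1 : ∀ k, lam k * (∑ i, (∑ j, v k j * v i j) * a t i)
        = ∑ i, ∑ j, (lam k * v k j) * (v i j * a t i) := by
      intro k
      rw [Finset.mul_sum]
      refine Finset.sum_congr rfl fun i _ => ?_
      rw [Finset.sum_mul, Finset.mul_sum]
      exact Finset.sum_congr rfl fun j _ => by ring
    simp_rw [h1]
    rw [Finset.sum_comm]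
    refine Finset.sum_eq_zero fun i _ => ?_
    rw [Finset.sum_comm]
    refine Finset.sum_eq_zero fun j _ => ?_
    rw [← Finset.sum_mul, hlam j, zero_mul]
  have hd : ∀ t, HasDerivAt (fun s => ∑ i, lam i * b s i) 0 t := by
    intro t
    rw [← key t]
    exact HasDerivAt.fun_sum fun k _ => ((hsys t k).2).const_mul (lam k)
  exact is_const_of_deriv_eq_zero (fun t => (hd t).differentiableAt) (fun t => (hd t).deriv)
end

section
/- Let v_1, …, v_N ∈ ℝ^n and let π be the skew-symmetric (2N)×(2N) matrix-valued map on coordinates (a_1,…,a_N,b_1,…,b_N) determined by the brackets {b_i, a_j} = ⟨v_i, v_j⟩ a_j (all other brackets among the coordinates zero). Suppose λ_1, …, λ_N are integers with Σ_{i=1}^N λ_i v_i = 0. Then on the open set where all a_j ≠ 0, both F_1 = Σ_{i=1}^N λ_i b_i and F_2 = Π_{i=1}^N a_i^{λ_i} are Casimirs of π, i.e. π(a,b)·∇F_1(a,b) = 0 and π(a,b)·∇F_2(a,b) = 0. -/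
/-- For the skew-symmetric tensor `π` on coordinates `(a_1,…,a_N,b_1,…,b_N)`
determined by `{b_i, a_j} = ⟨v_i, v_j⟩ a_j` (all other brackets zero), and integers `λ_i` with
`Σ λ_i v_i = 0`, both `F₁ = Σ λ_i b_i` and `F₂ = Π a_i^{λ_i}` are Casimirs of `π` on the open
set where all `a_j ≠ 0`.  Here the index `Sum.inl j` is the `a_j`-coordinate and `Sum.inr i`
is the `b_i`-coordinate. -/
theorem F1_F2_casimirs
    (n N : ℕ) (v : Fin N → Fin n → ℝ) (lam : Fin N → ℤ)
    (hlam : ∀ j : Fin n, ∑ i, (lam i : ℝ) * v i j = 0)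
    (π : ((Fin N ⊕ Fin N) → ℝ) → (Fin N ⊕ Fin N) → (Fin N ⊕ Fin N) → ℝ)
    (hπba : ∀ x, ∀ i j : Fin N, π x (Sum.inr i) (Sum.inl j) = (∑ s, v i s * v j s) * x (Sum.inl j))
    (hπab : ∀ x, ∀ i j : Fin N,
      π x (Sum.inl j) (Sum.inr i) = -((∑ s, v i s * v j s) * x (Sum.inl j)))
    (hπaa : ∀ x, ∀ i j : Fin N, π x (Sum.inl i) (Sum.inl j) = 0)
    (hπbb : ∀ x, ∀ i j : Fin N, π x (Sum.inr i) (Sum.inr j) = 0)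
    (F₁ F₂ : ((Fin N ⊕ Fin N) → ℝ) → ℝ)
    (hF₁ : F₁ = fun x => ∑ i, (lam i : ℝ) * x (Sum.inr i))
    (hF₂ : F₂ = fun x => ∏ i, (x (Sum.inl i)) ^ (lam i)) :
    ∀ x : (Fin N ⊕ Fin N) → ℝ, (∀ j : Fin N, x (Sum.inl j) ≠ 0) →
      (∀ l : Fin N ⊕ Fin N,
        ∑ l' : Fin N ⊕ Fin N, π x l l' * fderiv ℝ F₁ x (Pi.single l' 1) = 0) ∧
      (∀ l : Fin N ⊕ Fin N,
        ∑ l' : Fin N ⊕ Fin N, π x l l' * fderiv ℝ F₂ x (Pi.single l' 1) = 0) := by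
  intro x hx
  have core : ∀ i, ∑ j, (∑ s, v i s * v j s) * (lam j : ℝ) = 0 := by
    intro i
    have h1 : ∀ j, (∑ s, v i s * v j s) * (lam j : ℝ)
        = ∑ s, v i s * ((lam j : ℝ) * v j s) := by
      intro j
      rw [Finset.sum_mul]
      exact Finset.sum_congr rfl fun s _ => by ring
    simp_rw [h1]
    rw [Finset.sum_comm]
    simp_rw [← Finset.mul_sum, hlam]
    simp
  have core2 : ∀ i, ∑ j, (∑ s, v j s * v i s) * (lam j : ℝ) = 0 := by
    intro i
    rw [← core i]
    refine Finset.sum_congr rfl fun j _ => ?_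
    congr 1
    exact Finset.sum_congr rfl fun s _ => mul_comm _ _
  let p : (Fin N ⊕ Fin N) → (((Fin N ⊕ Fin N) → ℝ) →L[ℝ] ℝ) :=
    fun l => ContinuousLinearMap.proj l
  have hp : ∀ l, HasFDerivAt (fun y : (Fin N ⊕ Fin N) → ℝ => y l) (p l) x :=
    fun l => (p l).hasFDerivAt
  have d1 : HasFDerivAt F₁ (∑ i, (lam i : ℝ) • p (Sum.inr i)) x := by
    rw [hF₁]
    exact HasFDerivAt.fun_sum fun i _ => (hp (Sum.inr i)).const_mul _
  have d2 : HasFDerivAt F₂ (∑ i, (∏ j ∈ Finset.univ.erase i, (x (Sum.inl j)) ^ (lam j)) •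
      (((lam i : ℝ) * (x (Sum.inl i)) ^ (lam i - 1)) • p (Sum.inl i))) x := by
    rw [hF₂]
    refine HasFDerivAt.finsetProd fun i _ => ?_
    have h := hasDerivAt_zpow (lam i) (x (Sum.inl i)) (Or.inl (hx i))
    exact HasDerivAt.comp_hasFDerivAt (h₂ := fun t : ℝ => t ^ lam i) x h (hp (Sum.inl i))
  have e1a : ∀ j, fderiv ℝ F₁ x (Pi.single (Sum.inl j) 1) = 0 := by
    intro j
    rw [d1.fderiv]
    simp [p]
  have e1b : ∀ j, fderiv ℝ F₁ x (Pi.single (Sum.inr j) 1) = lam j := by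
    intro j
    rw [d1.fderiv]
    simp [p, Pi.single_apply]
  have e2b : ∀ j, fderiv ℝ F₂ x (Pi.single (Sum.inr j) 1) = 0 := by
    intro j
    rw [d2.fderiv]
    simp [p]
  have e2a : ∀ j, x (Sum.inl j) * fderiv ℝ F₂ x (Pi.single (Sum.inl j) 1)
      = lam j * ∏ i, (x (Sum.inl i)) ^ (lam i) := by
    intro j
    have h : fderiv ℝ F₂ x (Pi.single (Sum.inl j) 1)
        = (∏ i ∈ Finset.univ.erase j, (x (Sum.inl i)) ^ (lam i)) *
          ((lam j : ℝ) * (x (Sum.inl j)) ^ (lam j - 1)) := by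
      rw [d2.fderiv]
      simp [p, Pi.single_apply]
    rw [h, ← Finset.mul_prod_erase Finset.univ _ (Finset.mem_univ j), zpow_sub_one₀ (hx j)]
    have := hx j
    field_simp
  refine ⟨?_, ?_⟩
  · rintro (l | l)
    · simp only [Fintype.sum_sum_type, hπaa, hπab, e1b, zero_mul, Finset.sum_const_zero, zero_add]
      rw [← neg_eq_zero, ← Finset.sum_neg_distrib, ← mul_zero (x (Sum.inl l)), ← core2 l,
        Finset.mul_sum]
      exact Finset.sum_congr rfl fun s _ => by ring
    · simp [Fintype.sum_sum_type, hπbb, e1a]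
  · rintro (l | l)
    · simp [Fintype.sum_sum_type, hπaa, e2b]
    · simp only [Fintype.sum_sum_type, hπbb, hπba, zero_mul, Finset.sum_const_zero, add_zero,
        mul_assoc, e2a]
      simp only [← mul_assoc]
      rw [← Finset.sum_mul, core, zero_mul]
end

section
/- Let n ≥ 2 and let u_1(t), …, u_{2n-1}(t) be a differentiable solution of the Kac–van Moerbeke (Volterra) system u̇_i = u_i(u_{i+1} − u_{i−1}) for i = 1, …, 2n−1 (with the conventions u_0 = u_{2n} = 0), with u_i(t) > 0 for all t and i. Define A_i(t) = −(1/2)√(u_{2i}(t) u_{2i−1}(t)) for i = 1, …, n−1 and B_i(t) = (1/2)(u_{2i−1}(t) + u_{2i−2}(t)) for i = 1, …, n (with u_0 = 0). Then (A, B) satisfies the Toda lattice equations in Flaschka form: Ȧ_i = A_i(B_{i+1} − B_i) for i = 1, …, n−1 and Ḃ_i = 2(A_i² − A_{i−1}²) for i = 1, …, n (with the conventions A_0 = A_n = 0). -/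
/-- The Hénon/Moser transformation
`A_i = -(1/2)√(u_{2i} u_{2i-1})`, `B_i = (1/2)(u_{2i-1} + u_{2i-2})`
maps positive solutions of the Kac–van Moerbeke (Volterra) system in `2n-1` variables
(`u̇_i = u_i(u_{i+1} - u_{i-1})`, with `u_0 = u_{2n} = 0`) to solutions of the Toda lattice in
Flaschka form `Ȧ_i = A_i(B_{i+1} - B_i)`, `Ḃ_i = 2(A_i² - A_{i-1}²)` (with `A_0 = A_n = 0`,
encoded by the `if` in the definition of `A`). -/
theorem KM_to_Toda
    (n : ℕ) (hn : 2 ≤ n) (u : ℝ → ℕ → ℝ)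
    (hu0 : ∀ t, u t 0 = 0) (hu2n : ∀ t, u t (2*n) = 0)
    (hpos : ∀ t, ∀ i, 1 ≤ i → i ≤ 2*n - 1 → 0 < u t i)
    (hode : ∀ t, ∀ i, 1 ≤ i → i ≤ 2*n - 1 →
      HasDerivAt (fun s => u s i) (u t i * (u t (i+1) - u t (i-1))) t)
    (A B : ℝ → ℕ → ℝ)
    (hA : ∀ t, ∀ i,
      A t i = if 1 ≤ i ∧ i ≤ n - 1 then -(1/2) * Real.sqrt (u t (2*i) * u t (2*i - 1)) else 0)
    (hB : ∀ t, ∀ i, 1 ≤ i → i ≤ n → B t i = (1/2) * (u t (2*i - 1) + u t (2*i - 2))) :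
    ∀ t, (∀ i, 1 ≤ i → i ≤ n - 1 →
        HasDerivAt (fun s => A s i) (A t i * (B t (i+1) - B t i)) t) ∧
      (∀ i, 1 ≤ i → i ≤ n →
        HasDerivAt (fun s => B s i) (2 * ((A t i)^2 - (A t (i-1))^2)) t) := by
  have hsq : ∀ t i, i ≤ n → (A t i)^2 = (1/4) * (u t (2*i) * u t (2*i - 1)) := by
    intro t i hi
    rw [hA]
    split_ifs with h
    · have h1 := hpos t (2*i) (by omega) (by omega)
      have h2 := hpos t (2*i-1) (by omega) (by omega)
      rw [mul_pow, Real.sq_sqrt (by positivity)]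
      norm_num
    · have h3 : i = 0 ∨ i = n := by omega
      rcases h3 with rfl | rfl
      · simp [hu0]
      · simp [hu2n]
  intro t
  refine ⟨?_, ?_⟩
  · intro i h1 h2
    obtain ⟨k, rfl⟩ : ∃ k, i = k + 1 := ⟨i - 1, by omega⟩
    have e1 := hode t (2*k+2) (by omega) (by omega)
    have e2 := hode t (2*k+1) (by omega) (by omega)
    have p1 := hpos t (2*k+2) (by omega) (by omega)
    have p2 := hpos t (2*k+1) (by omega) (by omega)
    have hAk : ∀ s, A s (k+1) = -(1/2) * Real.sqrt (u s (2*k+2) * u s (2*k+1)) := by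
      intro s
      rw [hA, if_pos ⟨h1, h2⟩]
      rfl
    have hB1 : B t (k+1+1) = (1/2) * (u t (2*k+3) + u t (2*k+2)) :=
      hB t (k+1+1) (by omega) (by omega)
    have hB2 : B t (k+1) = (1/2) * (u t (2*k+1) + u t (2*k)) :=
      hB t (k+1) (by omega) (by omega)
    have hp : 0 < u t (2*k+2) * u t (2*k+1) := mul_pos p1 p2
    have hs := Real.sqrt_pos.mpr hp
    have hs2 := Real.sq_sqrt hp.le
    have key := ((e1.mul e2).sqrt hp.ne').const_mul (-(1/2) : ℝ)
    simp only [hAk, hB1, hB2]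
    refine key.congr_deriv ?_
    simp only [Pi.mul_apply, Nat.add_sub_cancel, show 2*k+2-1 = 2*k+1 from rfl,
      show 2*k+2+1 = 2*k+3 from rfl, show 2*k+1+1 = 2*k+2 from rfl]
    field_simp
    rw [hs2]
    ring
  · intro i h1 h2
    obtain ⟨k, rfl⟩ : ∃ k, i = k + 1 := ⟨i - 1, by omega⟩
    have e2 := hode t (2*k+1) (by omega) (by omega)
    have e1 : HasDerivAt (fun s => u s (2*k)) (u t (2*k) * (u t (2*k+1) - u t (2*k-1))) t := by
      rcases Nat.eq_zero_or_pos k with rfl | hk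
      · simpa [hu0] using hasDerivAt_const t (0:ℝ)
      · exact hode t (2*k) (by omega) (by omega)
    have hBk : ∀ s, B s (k+1) = (1/2) * (u s (2*k+1) + u s (2*k)) :=
      fun s => hB s (k+1) (by omega) (by omega)
    have q1 : (A t (k+1))^2 = (1/4) * (u t (2*k+2) * u t (2*k+1)) := hsq t (k+1) h2
    have q2 : (A t (k+1-1))^2 = (1/4) * (u t (2*k) * u t (2*k-1)) := hsq t k (by omega)
    rw [q1, q2]
    simp only [hBk]
    refine ((e2.add e1).const_mul (1/2 : ℝ)).congr_deriv ?_
    simp only [Nat.add_sub_cancel, show 2*k+1+1 = 2*k+2 from rfl]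
    ring
end

section
/- Fix n ≥ 4. The skew-symmetric matrix-valued map π_3 on ℝ^n with coordinates (v_1, …, v_n), determined by the brackets {v_1,v_2} = v_1 v_2 (2v_1 + v_2); {v_i,v_{i+1}} = v_i v_{i+1}(v_i + v_{i+1}) for i = 2, …, n−3; {v_{n−2},v_{n−1}} = v_{n−2} v_{n−1}(2v_{n−1} + v_{n−2}); {v_{n−1},v_n} = 2 v_{n−1} v_n (v_n − v_{n−1}); {v_i,v_{i+2}} = v_i v_{i+1} v_{i+2} for i = 1, …, n−3; {v_{n−2},v_n} = v_{n−2} v_n (v_{n−2} + 2v_n); {v_{n−3},v_n} = v_{n−3} v_{n−2} v_n; and all other brackets zero, is a Poisson tensor, i.e. it satisfies the Jacobi identity Σ_l (π_{li} ∂π_{jk}/∂v_l + π_{lj} ∂π_{ki}/∂v_l + π_{lk} ∂π_{ij}/∂v_l) = 0 for all i, j, k. -/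
/-- `coord n x i` is the 1-based `i`-th coordinate `v_i` of `x : ℝⁿ` (0 out of range). -/
noncomputable def coord (n : ℕ) (x : Fin n → ℝ) (i : ℕ) : ℝ :=
  if h : 1 ≤ i ∧ i ≤ n then x ⟨i - 1, by omega⟩ else 0

/-- The cubic bracket `{v_i, v_j}` (for `i < j`) of the Bogoyavlensky–Volterra `D_{n+1}`
system. -/
noncomputable def pi3B (n : ℕ) (x : Fin n → ℝ) (i j : ℕ) : ℝ :=
  if i = 1 ∧ j = 2 then coord n x 1 * coord n x 2 * (2 * coord n x 1 + coord n x 2)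
  else if 2 ≤ i ∧ i ≤ n - 3 ∧ j = i + 1 then
    coord n x i * coord n x (i+1) * (coord n x i + coord n x (i+1))
  else if i = n - 2 ∧ j = n - 1 then
    coord n x (n-2) * coord n x (n-1) * (2 * coord n x (n-1) + coord n x (n-2))
  else if i = n - 1 ∧ j = n then
    2 * coord n x (n-1) * coord n x n * (coord n x n - coord n x (n-1))
  else if 1 ≤ i ∧ i ≤ n - 3 ∧ j = i + 2 then
    coord n x i * coord n x (i+1) * coord n x (i+2)
  else if i = n - 2 ∧ j = n then
    coord n x (n-2) * coord n x n * (coord n x (n-2) + 2 * coord n x n)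
  else if i = n - 3 ∧ j = n then
    coord n x (n-3) * coord n x (n-2) * coord n x n
  else 0

/-- The skew-symmetric matrix `π₃` (1-based entries `π₃_{ij} = {v_i, v_j}`). -/
noncomputable def pi3 (n : ℕ) (x : Fin n → ℝ) (i j : ℕ) : ℝ :=
  if i < j then pi3B n x i j else if j < i then -(pi3B n x j i) else 0

set_option linter.unusedSimpArgs false

/-- coefficient of `v_i` in `{v_i, v_j} / (v_i v_j)`, for `i < j` -/
noncomputable def coefa (n i j : ℕ) : ℝ :=
  if j = i + 1 then (if i = 1 then 2 else if j = n then -2 else 1)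
  else if j = i + 2 ∧ j = n then 1 else 0

/-- coefficient of `v_j` -/
noncomputable def coefb (n i j : ℕ) : ℝ :=
  if j = i + 1 then (if i + 3 ≤ n then 1 else 2)
  else if j = i + 2 ∧ j = n then 2 else 0

/-- coefficient of `v_{i+1}` -/
noncomputable def coefc (n i j : ℕ) : ℝ :=
  if (j = i + 2 ∧ j < n) ∨ (j = i + 3 ∧ j = n) then 1 else 0

noncomputable def BB (n : ℕ) (v : ℕ → ℝ) (i j : ℕ) : ℝ :=
  v i * v j * (coefa n i j * v i + coefb n i j * v j + coefc n i j * v (i + 1))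

noncomputable def dBB (n : ℕ) (v w : ℕ → ℝ) (i j : ℕ) : ℝ :=
  (w i * v j + v i * w j) * (coefa n i j * v i + coefb n i j * v j + coefc n i j * v (i + 1))
    + v i * v j * (coefa n i j * w i + coefb n i j * w j + coefc n i j * w (i + 1))

noncomputable def PP (n : ℕ) (v : ℕ → ℝ) (i j : ℕ) : ℝ :=
  if i < j then BB n v i j else if j < i then -(BB n v j i) else 0

noncomputable def dPP (n : ℕ) (v w : ℕ → ℝ) (i j : ℕ) : ℝ :=
  if i < j then dBB n v w i j else if j < i then -(dBB n v w j i) else 0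

lemma pi3B_eq (n : ℕ) (hn : 4 ≤ n) (x : Fin n → ℝ) (i j : ℕ) (hi : 1 ≤ i) (hij : i < j)
    (hj : j ≤ n) : pi3B n x i j = BB n (coord n x) i j := by
  unfold pi3B BB coefa coefb coefc
  by_cases h1 : j = i + 1
  · subst h1
    by_cases h2 : i = 1
    · subst h2
      simp (disch := omega) only [if_pos, if_neg, and_true, true_and, and_false,
    false_and, or_true, true_or, or_false, false_or, if_true, if_false]
      ring
    by_cases h3 : i + 3 ≤ n
    · simp (disch := omega) only [if_pos, if_neg, and_true, true_and, and_false,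
    false_and, or_true, true_or, or_false, false_or, if_true, if_false]
      ring
    by_cases h4 : i + 1 = n
    · subst h4
      simp (disch := omega) only [if_pos, if_neg, and_true, true_and, and_false,
    false_and, or_true, true_or, or_false, false_or, if_true, if_false]
      simp only [Nat.add_sub_cancel]
      ring
    · obtain rfl : n = i + 2 := by omega
      simp (disch := omega) only [if_pos, if_neg, and_true, true_and, and_false,
    false_and, or_true, true_or, or_false, false_or, if_true, if_false]
      simp only [Nat.add_sub_cancel, show i + 2 - 1 = i + 1 by omega]
      ring
  by_cases h2 : j = i + 2
  · subst h2
    by_cases h3 : i + 2 = n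
    · subst h3
      simp (disch := omega) only [if_pos, if_neg, and_true, true_and, and_false,
    false_and, or_true, true_or, or_false, false_or, if_true, if_false]
      simp only [Nat.add_sub_cancel]
      ring
    · simp (disch := omega) only [if_pos, if_neg, and_true, true_and, and_false,
    false_and, or_true, true_or, or_false, false_or, if_true, if_false]
      ring
  by_cases h3 : j = i + 3 ∧ j = n
  · obtain ⟨rfl, rfl⟩ := h3
    simp (disch := omega) only [if_pos, if_neg, and_true, true_and, and_false,
    false_and, or_true, true_or, or_false, false_or, if_true, if_false]
    simp only [Nat.add_sub_cancel, show i + 3 - 2 = i + 1 by omega]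
    ring
  · simp (disch := omega) only [if_pos, if_neg, and_true, true_and, and_false,
    false_and, or_true, true_or, or_false, false_or, if_true, if_false]
    ring

lemma pi3_eq (n : ℕ) (hn : 4 ≤ n) (x : Fin n → ℝ) (i j : ℕ) (hi : 1 ≤ i) (hi' : i ≤ n)
    (hj : 1 ≤ j) (hj' : j ≤ n) : pi3 n x i j = PP n (coord n x) i j := by
  unfold pi3 PP
  split_ifs with h1 h2
  · exact pi3B_eq n hn x i j hi h1 hj'
  · rw [pi3B_eq n hn x j i hj h2 hi']
  · rfl

lemma coord_hasFDerivAt (n : ℕ) (x : Fin n → ℝ) (m : ℕ) :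
    ∃ L : (Fin n → ℝ) →L[ℝ] ℝ, HasFDerivAt (fun y => coord n y m) L x ∧
      ∀ V, L V = coord n V m := by
  unfold coord
  split_ifs with h
  · exact ⟨ContinuousLinearMap.proj (R := ℝ) (φ := fun _ : Fin n => ℝ) ⟨m - 1, by omega⟩,
      hasFDerivAt_apply _ _, fun V => rfl⟩
  · exact ⟨0, hasFDerivAt_const _ _, fun V => rfl⟩

lemma BB_hasFDerivAt (n : ℕ) (x : Fin n → ℝ) (i j : ℕ) :
    ∃ L : (Fin n → ℝ) →L[ℝ] ℝ, HasFDerivAt (fun y => BB n (coord n y) i j) L x ∧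
      ∀ V, L V = dBB n (coord n x) (coord n V) i j := by
  obtain ⟨L1, h1, e1⟩ := coord_hasFDerivAt n x i
  obtain ⟨L2, h2, e2⟩ := coord_hasFDerivAt n x j
  obtain ⟨L3, h3, e3⟩ := coord_hasFDerivAt n x (i + 1)
  refine ⟨_, (h1.mul h2).mul (((h1.const_mul (coefa n i j)).add (h2.const_mul (coefb n i j))).add
    (h3.const_mul (coefc n i j))), fun V => ?_⟩
  simp [dBB, e1, e2, e3]
  ring

lemma PP_fderiv (n : ℕ) (x V : Fin n → ℝ) (i j : ℕ) :
    fderiv ℝ (fun y => PP n (coord n y) i j) x V = dPP n (coord n x) (coord n V) i j := by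
  unfold PP dPP
  split_ifs with h1 h2
  · obtain ⟨L, h, e⟩ := BB_hasFDerivAt n x i j
    rw [h.fderiv, e]
  · obtain ⟨L, h, e⟩ := BB_hasFDerivAt n x j i
    rw [h.fun_neg.fderiv]
    simp [e]
  · simp

lemma dBB_congr (n : ℕ) (v w w' : ℕ → ℝ) (i j : ℕ) (hij : i < j)
    (h : ∀ l, i ≤ l → l ≤ j → w l = w' l) : dBB n v w i j = dBB n v w' i j := by
  unfold dBB
  rw [h i le_rfl hij.le, h j hij.le le_rfl, h (i + 1) (by omega) (by omega)]

lemma dPP_congr (n : ℕ) (v w w' : ℕ → ℝ) (i j : ℕ) (hi : 1 ≤ i) (hi' : i ≤ n)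
    (hj : 1 ≤ j) (hj' : j ≤ n)
    (h : ∀ l, 1 ≤ l → l ≤ n → w l = w' l) : dPP n v w i j = dPP n v w' i j := by
  unfold dPP
  split_ifs with h1 h2
  · exact dBB_congr _ _ _ _ _ _ h1 fun l _ _ => h l (by omega) (by omega)
  · rw [dBB_congr _ _ _ _ _ _ h2 fun l _ _ => h l (by omega) (by omega)]
  · rfl

lemma BB_far (n : ℕ) (v : ℕ → ℝ) (i j : ℕ) (h : i + 4 ≤ j) : BB n v i j = 0 := by
  unfold BB coefa coefb coefc
  simp (disch := omega) only [if_neg, and_true, true_and, and_false,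
    false_and, or_true, true_or, or_false, false_or, if_true, if_false]
  ring

lemma dBB_far (n : ℕ) (v w : ℕ → ℝ) (i j : ℕ) (h : i + 4 ≤ j) : dBB n v w i j = 0 := by
  unfold dBB coefa coefb coefc
  simp (disch := omega) only [if_neg, and_true, true_and, and_false,
    false_and, or_true, true_or, or_false, false_or, if_true, if_false]
  ring

lemma dBB_zero (n : ℕ) (v w : ℕ → ℝ) (i j : ℕ) (hij : i < j)
    (h : ∀ l, i ≤ l → l ≤ j → w l = 0) : dBB n v w i j = 0 := by
  unfold dBB
  rw [h i le_rfl hij.le, h j hij.le le_rfl, h (i + 1) (by omega) (by omega)]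
  ring

lemma PP_far (n : ℕ) (v : ℕ → ℝ) (i j : ℕ) (h : i + 4 ≤ j ∨ j + 4 ≤ i) : PP n v i j = 0 := by
  unfold PP
  split_ifs with h1 h2
  · exact BB_far _ _ _ _ (by omega)
  · rw [BB_far _ _ _ _ (by omega), neg_zero]
  · rfl

noncomputable def JJ (n : ℕ) (v : ℕ → ℝ) (i j k : ℕ) : ℝ :=
  dPP n v (fun l => PP n v l i) j k + dPP n v (fun l => PP n v l j) k i
    + dPP n v (fun l => PP n v l k) i j

lemma dPP_swap (n : ℕ) (v w : ℕ → ℝ) (i j : ℕ) : dPP n v w j i = -dPP n v w i j := by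
  unfold dPP
  split_ifs <;> first | omega | simp

lemma JJ_cyc (n : ℕ) (v : ℕ → ℝ) (i j k : ℕ) : JJ n v j k i = JJ n v i j k := by
  unfold JJ; ring

lemma JJ_swap (n : ℕ) (v : ℕ → ℝ) (i j k : ℕ) : JJ n v j i k = -JJ n v i j k := by
  unfold JJ
  rw [dPP_swap n v _ k i, dPP_swap n v _ j k, dPP_swap n v _ i j]; ring

lemma JJ_lt (n : ℕ) (v : ℕ → ℝ) (i j k : ℕ) (hij : i < j) (hjk : j < k) : JJ n v i j k =
    dBB n v (fun l => PP n v l i) j k - dBB n v (fun l => PP n v l j) i k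
    + dBB n v (fun l => PP n v l k) i j := by
  unfold JJ dPP
  simp (disch := omega) only [if_pos, if_neg, and_true, true_and, and_false,
    false_and, or_true, true_or, or_false, false_or, if_true, if_false]
  ring

set_option maxHeartbeats 4000000 in
lemma JJ_near (n : ℕ) (hn : 4 ≤ n) (v : ℕ → ℝ) (i a b m : ℕ) (hi : 1 ≤ i) (ha : 1 ≤ a)
    (ha' : a ≤ 3) (hb : 1 ≤ b) (hb' : b ≤ 3) (hm : n = i + a + b + m) :
    JJ n v i (i + a) (i + a + b) = 0 := by
  rw [JJ_lt n v _ _ _ (by omega) (by omega)]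
  have hm3 : m = 0 ∨ m = 1 ∨ m = 2 ∨ 3 ≤ m := by omega
  have hi3 : i = 1 ∨ 2 ≤ i := by omega
  unfold dBB PP BB coefa coefb coefc
  interval_cases a <;> interval_cases b <;> rcases hi3 with rfl | hi3 <;>
    rcases hm3 with rfl | rfl | rfl | hm3 <;>
    first
    | omega
    | (subst hm
       simp (disch := omega) only [if_pos, if_neg, add_assoc, Nat.reduceAdd, and_true, true_and, and_false,
    false_and, or_true, true_or, or_false, false_or, if_true, if_false]
       ring)

lemma JJ_sorted (n : ℕ) (hn : 4 ≤ n) (v : ℕ → ℝ) (i j k : ℕ) (hi : 1 ≤ i) (hij : i < j)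
    (hjk : j < k) (hk : k ≤ n) : JJ n v i j k = 0 := by
  by_cases h1 : i + 4 ≤ j
  · rw [JJ_lt n v _ _ _ hij hjk, dBB_far n v _ i k (by omega), dBB_far n v _ i j h1,
      dBB_zero n v _ j k hjk fun l _ _ => PP_far _ _ _ _ (by omega)]
    ring
  by_cases h2 : j + 4 ≤ k
  · rw [JJ_lt n v _ _ _ hij hjk, dBB_far n v _ i k (by omega), dBB_far n v _ j k h2,
      dBB_zero n v _ i j hij fun l _ _ => PP_far _ _ _ _ (by omega)]
    ring
  have := JJ_near n hn v i (j - i) (k - j) (n - k) hi (by omega) (by omega) (by omega) (by omega)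
    (by omega)
  rwa [show i + (j - i) = j by omega, show j + (k - j) = k by omega] at this

lemma JJ_zero (n : ℕ) (hn : 4 ≤ n) (v : ℕ → ℝ) (i j k : ℕ) (hi : 1 ≤ i) (hi' : i ≤ n)
    (hj : 1 ≤ j) (hj' : j ≤ n) (hk : 1 ≤ k) (hk' : k ≤ n) : JJ n v i j k = 0 := by
  have key : ∀ a b c, 1 ≤ a → a ≤ n → 1 ≤ b → b ≤ n → 1 ≤ c → c ≤ n → a ≤ b → a ≤ c →
      JJ n v a b c = 0 := by
    intro a b c h1 h2 h3 h4 h5 h6 h7 h8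
    by_cases e1 : a = b
    · subst e1; have := JJ_swap n v a a c; linarith
    by_cases e2 : a = c
    · subst e2; have := JJ_swap n v a a b; have := JJ_cyc n v a a b; have := JJ_cyc n v a b a
      linarith
    by_cases e3 : b = c
    · subst e3; have := JJ_swap n v b b a; have := JJ_cyc n v a b b
      linarith
    rcases lt_or_gt_of_ne e3 with h | h
    · exact JJ_sorted n hn v a b c h1 (by omega) h h6
    · have := JJ_sorted n hn v a c b h1 (by omega) h h4
      have h' := JJ_swap n v c a b
      have h'' := JJ_cyc n v c a b
      linarith
  by_cases c1 : i ≤ j ∧ i ≤ k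
  · exact key i j k hi hi' hj hj' hk hk' c1.1 c1.2
  by_cases c2 : j ≤ k ∧ j ≤ i
  · rw [← JJ_cyc]; exact key j k i hj hj' hk hk' hi hi' c2.1 c2.2
  · rw [← JJ_cyc, ← JJ_cyc]; exact key k i j hk hk' hi hi' hj hj' (by omega) (by omega)

lemma sum_fderiv (n : ℕ) (hn : 4 ≤ n) (x : Fin n → ℝ) (i j k : ℕ) (hi : 1 ≤ i) (hi' : i ≤ n)
    (hj : 1 ≤ j) (hj' : j ≤ n) (hk : 1 ≤ k) (hk' : k ≤ n) :
    ∑ l : Fin n, pi3 n x ((l : ℕ) + 1) i * fderiv ℝ (fun y => pi3 n y j k) x (Pi.single l 1)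
      = dPP n (coord n x) (fun l => PP n (coord n x) l i) j k := by
  have e : (fun y => pi3 n y j k) = fun y => PP n (coord n y) j k :=
    funext fun y => pi3_eq n hn y j k hj hj' hk hk'
  rw [e]
  set F := fderiv ℝ (fun y => PP n (coord n y) j k) x with hF
  have h : ∑ l : Fin n, pi3 n x ((l : ℕ) + 1) i * F (Pi.single l 1)
      = F (fun l : Fin n => pi3 n x ((l : ℕ) + 1) i) := by
    conv_rhs => rw [pi_eq_sum_univ' (fun l : Fin n => pi3 n x ((l : ℕ) + 1) i)]
    rw [map_sum]
    refine Finset.sum_congr rfl fun l _ => ?_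
    rw [map_smul, smul_eq_mul]
  rw [h, hF, PP_fderiv]
  refine dPP_congr _ _ _ _ _ _ hj hj' hk hk' fun l h1 h2 => ?_
  have h3 : l - 1 + 1 = l := by omega
  simp only [coord, dif_pos (And.intro h1 h2), h3]
  exact pi3_eq n hn x l i h1 h2 hi hi'

/-- the cubic tensor `π₃` is Poisson: it satisfies the Jacobi identity
`Σ_l (π_{li} ∂π_{jk}/∂v_l + π_{lj} ∂π_{ki}/∂v_l + π_{lk} ∂π_{ij}/∂v_l) = 0`. -/
theorem pi3_is_poisson (n : ℕ) (hn : 4 ≤ n) (x : Fin n → ℝ)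
    (i j k : ℕ) (hi1 : 1 ≤ i) (hi2 : i ≤ n) (hj1 : 1 ≤ j) (hj2 : j ≤ n)
    (hk1 : 1 ≤ k) (hk2 : k ≤ n) :
    ∑ l : Fin n,
      (pi3 n x ((l : ℕ) + 1) i * fderiv ℝ (fun y => pi3 n y j k) x (Pi.single l 1)
        + pi3 n x ((l : ℕ) + 1) j * fderiv ℝ (fun y => pi3 n y k i) x (Pi.single l 1)
        + pi3 n x ((l : ℕ) + 1) k * fderiv ℝ (fun y => pi3 n y i j) x (Pi.single l 1)) = 0 := by
  simp only [Finset.sum_add_distrib]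
  rw [sum_fderiv n hn x i j k hi1 hi2 hj1 hj2 hk1 hk2,
    sum_fderiv n hn x j k i hj1 hj2 hk1 hk2 hi1 hi2,
    sum_fderiv n hn x k i j hk1 hk2 hi1 hi2 hj1 hj2]
  exact JJ_zero n hn (coord n x) i j k hi1 hi2 hj1 hj2 hk1 hk2
end

section
/- Fix odd n = 2m+1 ≥ 5. On the open set of ℝ^n where all coordinates v_i are nonzero, define τ_{ii} = v_{2i−1} and, for i < j, τ_{ij} = −τ_{ji} = v_{2i−1} Π_{k=i}^{j−1} (v_{2k+1}/v_{2k}). The skew-symmetric matrix-valued map π_1 determined by the brackets {v_i,v_j} = (−1)^{i+j−1} τ_{⌊i/2⌋+1, ⌊(j+1)/2⌋} for 1 ≤ i < j ≤ n−2; {v_i,v_{n−1}} = {v_i,v_n} = ((−1)^{i+n}/2) τ_{⌊i/2⌋+1, ⌊n/2⌋} for i = 1, …, n−2; and {v_{n−1},v_n} = (1/2)(v_n − v_{n−1}), is a Poisson tensor, i.e. it satisfies the Jacobi identity Σ_l (π_{li} ∂π_{jk}/∂v_l + π_{lj} ∂π_{ki}/∂v_l + π_{lk} ∂π_{ij}/∂v_l)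 = 0 for all i, j, k. -/
/-- `τ_{ij} = v_{2i-1} Π_{k=i}^{j-1} (v_{2k+1}/v_{2k})` for `i ≤ j` (so `τ_{ii} = v_{2i-1}`). -/
noncomputable def tauD (n : ℕ) (x : Fin n → ℝ) (i j : ℕ) : ℝ :=
  coord n x (2*i - 1) * ∏ k ∈ Finset.Ico i j, (coord n x (2*k + 1) / coord n x (2*k))

/-- The linear/rational bracket `{v_i, v_j}` (for `i < j`) of the `D_{n+1}` Volterra system. -/
noncomputable def pi1B (n : ℕ) (x : Fin n → ℝ) (i j : ℕ) : ℝ :=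
  if 1 ≤ i ∧ i < j ∧ j ≤ n - 2 then
    (-1 : ℝ)^(i + j - 1) * tauD n x (i/2 + 1) ((j+1)/2)
  else if 1 ≤ i ∧ i ≤ n - 2 ∧ (j = n - 1 ∨ j = n) then
    ((-1 : ℝ)^(i + n) / 2) * tauD n x (i/2 + 1) (n/2)
  else if i = n - 1 ∧ j = n then (1/2) * (coord n x n - coord n x (n-1))
  else 0

/-- The skew-symmetric matrix `π₁` (1-based entries `π₁_{ij} = {v_i, v_j}`). -/
noncomputable def pi1 (n : ℕ) (x : Fin n → ℝ) (i j : ℕ) : ℝ :=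
  if i < j then pi1B n x i j else if j < i then -(pi1B n x j i) else 0

lemma diff_div {n : ℕ} {f g : (Fin n → ℝ) → ℝ} {x : Fin n → ℝ}
    (hf : DifferentiableAt ℝ f x) (hg : DifferentiableAt ℝ g x) (h0 : g x ≠ 0) :
    DifferentiableAt ℝ (fun y => f y / g y) x := by
  simp only [div_eq_mul_inv]
  exact hf.mul (hg.inv h0)

/-- Alternating products `v_1 v_2⁻¹ v_3 ⋯` of the first `l` coordinates. -/
noncomputable def altC (n : ℕ) (y : Fin n → ℝ) : ℕ → ℝ
  | 0 => 1
  | l + 1 => if l % 2 = 0 then altC n y l * coord n y (l+1) else altC n y l / coord n y (l+1)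

lemma coord_ne {n : ℕ} {y : Fin n → ℝ} (hy : ∀ i, y i ≠ 0) {s : ℕ} (h1 : 1 ≤ s) (h2 : s ≤ n) :
    coord n y s ≠ 0 := by
  unfold coord
  rw [dif_pos ⟨h1, h2⟩]
  exact hy _

lemma altC_ne {n : ℕ} {y : Fin n → ℝ} (hy : ∀ i, y i ≠ 0) (l : ℕ) (h2 : l ≤ n) :
    altC n y l ≠ 0 := by
  induction l with
  | zero => simp [altC]
  | succ l ih =>
    have h := coord_ne hy (s := l+1) (by omega) h2
    have h' := ih (by omega)
    unfold altC
    split_ifs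
    · exact mul_ne_zero h' h
    · exact div_ne_zero h' h

lemma altC_odd (n : ℕ) (y : Fin n → ℝ) (a : ℕ) :
    altC n y (2*a+1) = altC n y (2*a) * coord n y (2*a+1) := by
  rw [altC, if_pos (by omega)]

lemma altC_even (n : ℕ) (y : Fin n → ℝ) (a : ℕ) :
    altC n y (2*a+2) = altC n y (2*a+1) / coord n y (2*a+2) := by
  rw [altC, if_neg (by omega)]

lemma tauD_eq {n : ℕ} {y : Fin n → ℝ} (hy : ∀ i, y i ≠ 0) (a d : ℕ) (h : 2*(a+d)+1 ≤ n) :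
    tauD n y (a+1) (a+1+d) = altC n y (2*(a+d)+1) / altC n y (2*a) := by
  induction d with
  | zero =>
    have h0 := altC_ne hy (2*a) (by omega)
    rw [add_zero, altC_odd]
    unfold tauD
    rw [show 2*(a+1)-1 = 2*a+1 by omega]
    simp
    field_simp
  | succ d ih =>
    have h0 := altC_ne hy (2*a) (by omega)
    have h1 := coord_ne hy (s := 2*(a+d)+2) (by omega) (by omega)
    have ih' := ih (by omega)
    have e : tauD n y (a+1) (a+1+(d+1)) = tauD n y (a+1) (a+1+d) *
        (coord n y (2*(a+d)+3) / coord n y (2*(a+d)+2)) := by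
      unfold tauD
      rw [show a+1+(d+1) = (a+1+d)+1 by ring, Finset.prod_Ico_succ_top (by omega)]
      rw [show 2*(a+1+d)+1 = 2*(a+d)+3 by ring, show 2*(a+1+d) = 2*(a+d)+2 by ring]
      ring
    rw [e, ih', show 2*(a+(d+1))+1 = 2*(a+d+1)+1 by ring, altC_odd n y (a+d+1),
      show 2*(a+d+1) = 2*(a+d)+2 by ring, altC_even, show 2*(a+d)+2+1 = 2*(a+d)+3 by ring]
    field_simp

/-- index of the numerator product -/
def bIdx (m j : ℕ) : ℕ := if j = 2*m+1 then 2*m-1 else 2*((j+1)/2)-1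

/-- weights of the numerators -/
noncomputable def wt (m j : ℕ) : ℝ := if j ≤ 2*m-1 then -(-1:ℝ)^j else -1/2

noncomputable def Tf (m : ℕ) (y : Fin (2*m+1) → ℝ) (j : ℕ) : ℝ :=
  wt m j * altC (2*m+1) y (bIdx m j)

noncomputable def Rf (m : ℕ) (y : Fin (2*m+1) → ℝ) (i : ℕ) : ℝ :=
  (-1:ℝ)^i / altC (2*m+1) y (2*(i/2))

lemma tauD_eq' {n : ℕ} {y : Fin n → ℝ} (hy : ∀ i, y i ≠ 0) (a b c : ℕ) (hab : a + 1 ≤ b)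
    (hc : c = 2*b-1) (h : c ≤ n) :
    tauD n y (a+1) b = altC n y c / altC n y (2*a) := by
  obtain ⟨d, rfl⟩ := Nat.exists_eq_add_of_le hab
  rw [tauD_eq hy a d (by omega)]
  congr 2
  omega

lemma pi1_eq (m : ℕ) {y : Fin (2*m+1) → ℝ} (hy : ∀ i, y i ≠ 0) (i j : ℕ) (hi : 1 ≤ i)
    (him : i ≤ 2*m-1) (hij : i < j) (hj : j ≤ 2*m+1) :
    pi1 (2*m+1) y i j = Rf m y i * Tf m y j := by
  unfold pi1 pi1B Rf Tf wt
  rw [if_pos hij]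
  by_cases h : j ≤ 2*m-1
  · rw [if_pos ⟨hi, hij, by omega⟩, if_pos h,
      tauD_eq' hy (i/2) ((j+1)/2) (bIdx m j) (by omega)
        (by unfold bIdx; rw [if_neg (by omega)]) (by unfold bIdx; split_ifs <;> omega)]
    obtain ⟨j, rfl⟩ : ∃ j', j = j' + 1 := ⟨j-1, by omega⟩
    rw [show i + (j+1) - 1 = i + j by omega, pow_add, pow_succ]
    ring
  · rw [if_neg (by omega), if_pos ⟨hi, by omega, by omega⟩, if_neg h,
      tauD_eq' hy (i/2) ((2*m+1)/2) (bIdx m j) (by omega)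
        (by unfold bIdx; split_ifs <;> omega) (by unfold bIdx; split_ifs <;> omega)]
    rw [pow_add, pow_succ, pow_mul]
    norm_num
    ring

lemma pi1_skew (n : ℕ) (y : Fin n → ℝ) (i j : ℕ) : pi1 n y i j = - pi1 n y j i := by
  unfold pi1
  rcases lt_trichotomy i j with h | h | h
  · rw [if_pos h, if_neg (by omega), if_pos h, neg_neg]
  · subst h; simp
  · rw [if_pos h, if_neg (by omega), if_pos h]

/-- the Hamiltonian vector field of the coordinate `k` -/
noncomputable def Wf (n : ℕ) (x : Fin n → ℝ) (k : ℕ) : Fin n → ℝ :=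
  fun l => pi1 n x ((l:ℕ)+1) k

lemma coord_hasFDerivAt_s6 (n : ℕ) (x : Fin n → ℝ) (s : ℕ) (h1 : 1 ≤ s) (h2 : s ≤ n) :
    HasFDerivAt (fun y => coord n y s)
      (ContinuousLinearMap.proj (R := ℝ) (φ := fun _ : Fin n => ℝ) ⟨s-1, by omega⟩) x := by
  have : (fun y : Fin n → ℝ => coord n y s) = fun y => y ⟨s-1, by omega⟩ := by
    funext y; unfold coord; rw [dif_pos ⟨h1, h2⟩]
  rw [this]
  exact hasFDerivAt_apply _ _

lemma coord_fderiv (n : ℕ) (x : Fin n → ℝ) (s k : ℕ) (h1 : 1 ≤ s) (h2 : s ≤ n) :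
    fderiv ℝ (fun y => coord n y s) x (Wf n x k) = pi1 n x s k := by
  rw [(coord_hasFDerivAt_s6 n x s h1 h2).fderiv]
  simp [Wf, Nat.sub_add_cancel h1]

lemma altC_diff {n : ℕ} {x : Fin n → ℝ} (hx : ∀ i, x i ≠ 0) (l : ℕ) (h2 : l ≤ n) :
    DifferentiableAt ℝ (fun y => altC n y l) x := by
  induction l with
  | zero => simp [altC]
  | succ l ih =>
    have h := (coord_hasFDerivAt_s6 n x (l+1) (by omega) h2).differentiableAt
    have h' := ih (by omega)
    unfold altC
    split_ifs
    · exact h'.mul h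
    · exact diff_div h' h (coord_ne hx (by omega) h2)

noncomputable def pf (m : ℕ) (x : Fin (2*m+1) → ℝ) (s : ℕ) : ℝ :=
  1 / altC (2*m+1) x (2*((s+1)/2)-1)
noncomputable def qf (m : ℕ) (x : Fin (2*m+1) → ℝ) (s : ℕ) : ℝ := altC (2*m+1) x (2*(s/2))
noncomputable def SP (m : ℕ) (x : Fin (2*m+1) → ℝ) (l : ℕ) : ℝ :=
  ∑ s ∈ Finset.range l, pf m x (s+1)
noncomputable def SQ (m : ℕ) (x : Fin (2*m+1) → ℝ) (l : ℕ) : ℝ :=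
  ∑ s ∈ Finset.range l, qf m x (s+1)
noncomputable def Ff (m : ℕ) (x : Fin (2*m+1) → ℝ) (k l : ℕ) : ℝ :=
  if l < k then Tf m x k * SP m x l
  else Tf m x k * SP m x (k-1) + Rf m x k * (SQ m x l - SQ m x k)

lemma fderiv_mul_W {n : ℕ} {f g : (Fin n → ℝ) → ℝ} {x W : Fin n → ℝ}
    (hf : DifferentiableAt ℝ f x) (hg : DifferentiableAt ℝ g x) :
    fderiv ℝ (fun y => f y * g y) x W = fderiv ℝ f x W * g x + f x * fderiv ℝ g x W := by
  rw [fderiv_fun_mul hf hg]; simp; ring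

lemma fderiv_div_W {n : ℕ} {f g : (Fin n → ℝ) → ℝ} {x W : Fin n → ℝ}
    (hf : DifferentiableAt ℝ f x) (hg : DifferentiableAt ℝ g x) (h0 : g x ≠ 0) :
    fderiv ℝ (fun y => f y / g y) x W =
      fderiv ℝ f x W / g x - f x * fderiv ℝ g x W / (g x)^2 := by
  have h := fderiv_mul_W (W := W) (diff_div hf hg h0) hg
  have e : fderiv ℝ (fun y => (f y / g y) * g y) x = fderiv ℝ f x := by
    apply Filter.EventuallyEq.fderiv_eq
    filter_upwards [hg.continuousAt.eventually_ne h0] with y hy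
    field_simp
  have h' : fderiv ℝ f x W = fderiv ℝ (fun y => f y / g y) x W * g x
      + f x / g x * fderiv ℝ g x W := by
    rw [← e]; exact h
  rw [h']; field_simp; ring

lemma Ff_step (m : ℕ) {x : Fin (2*m+1) → ℝ} (hx : ∀ i, x i ≠ 0) (k : ℕ)
    (hk : 1 ≤ k) (hk2 : k ≤ 2*m+1) (l : ℕ) (hl : l + 1 ≤ 2*m-1) :
    pi1 (2*m+1) x (l+1) k =
      (-1:ℝ)^(l+1) * coord (2*m+1) x (l+1) * (Ff m x k (l+1) - Ff m x k l) := by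
  have hc := coord_ne hx (s := l+1) (by omega) (by omega)
  have hC := altC_ne hx l (by omega)
  rcases lt_trichotomy (l+1) k with h | h | h
  · rw [pi1_eq m hx (l+1) k (by omega) hl h hk2]
    unfold Ff
    rw [if_pos h, if_pos (by omega)]
    have : SP m x (l+1) = SP m x l + pf m x (l+1) := by simp [SP, Finset.sum_range_succ]
    rw [this]
    suffices hs : Rf m x (l+1) = (-1:ℝ)^(l+1) * coord (2*m+1) x (l+1) * pf m x (l+1) by
      rw [hs]; ring
    unfold Rf pf
    rcases Nat.even_or_odd' l with ⟨a, rfl | rfl⟩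
    · rw [show 2*((2*a+1)/2) = 2*a by omega, show 2*((2*a+1+1)/2)-1 = 2*a+1 by omega, altC_odd]
      field_simp
    · have hC' := altC_ne hx (2*a) (by omega)
      rw [show 2*((2*a+1+1)/2) = 2*a+2 by omega, show 2*((2*a+1+1+1)/2)-1 = 2*a+1 by omega,
        altC_even]
      field_simp
  · subst h
    unfold Ff pi1
    simp
  · rw [pi1_skew, pi1_eq m hx k (l+1) hk (by omega) h (by omega)]
    unfold Ff
    rw [if_neg (by omega), if_neg (by omega)]
    have : SQ m x (l+1) = SQ m x l + qf m x (l+1) := by simp [SQ, Finset.sum_range_succ]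
    rw [this]
    suffices hs : Tf m x (l+1) = -(-1:ℝ)^(l+1) * coord (2*m+1) x (l+1) * qf m x (l+1) by
      rw [hs]; ring
    unfold Tf qf wt bIdx
    rw [if_pos hl, if_neg (by omega)]
    rcases Nat.even_or_odd' l with ⟨a, rfl | rfl⟩
    · rw [show 2*((2*a+1)/2) = 2*a by omega, show 2*((2*a+1+1)/2)-1 = 2*a+1 by omega, altC_odd]
      ring
    · rw [show 2*((2*a+1+1)/2) = 2*a+2 by omega, show 2*((2*a+1+1+1)/2)-1 = 2*a+1 by omega,
        altC_even]
      rw [show 2*a+1+1 = 2*a+2 by ring] at hc ⊢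
      field_simp

lemma altC_fderiv (m : ℕ) {x : Fin (2*m+1) → ℝ} (hx : ∀ i, x i ≠ 0) (k : ℕ)
    (hk : 1 ≤ k) (hk2 : k ≤ 2*m+1) (l : ℕ) (hl : l ≤ 2*m-1) :
    fderiv ℝ (fun y => altC (2*m+1) y l) x (Wf (2*m+1) x k)
      = - altC (2*m+1) x l * Ff m x k l := by
  induction l with
  | zero =>
    have : Ff m x k 0 = 0 := by
      unfold Ff; rw [if_pos (by omega)]; simp [SP]
    simp [altC, this]
  | succ l ih =>
    have ih' := ih (by omega)
    have hd := altC_diff hx l (by omega)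
    have hd' := (coord_hasFDerivAt_s6 (2*m+1) x (l+1) (by omega) (by omega)).differentiableAt
    have hc := coord_ne hx (s := l+1) (by omega) (by omega)
    have hs := Ff_step m hx k hk hk2 l hl
    have hD := coord_fderiv (2*m+1) x (l+1) k (by omega) (by omega)
    unfold altC
    split_ifs with hp
    · rw [fderiv_mul_W hd hd', ih', hD, hs, Odd.neg_one_pow (by rw [Nat.odd_iff]; omega)]
      ring
    · rw [fderiv_div_W hd hd' hc, ih', hD, hs, Even.neg_one_pow (by rw [Nat.even_iff]; omega)]
      field_simp
      ring

lemma pi1_fderiv (m : ℕ) {x : Fin (2*m+1) → ℝ} (hx : ∀ i, x i ≠ 0) (i j k : ℕ)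
    (hk : 1 ≤ k) (hk2 : k ≤ 2*m+1) (hi : 1 ≤ i)
    (him : i ≤ 2*m-1) (hij : i < j) (hj : j ≤ 2*m+1) :
    fderiv ℝ (fun y => pi1 (2*m+1) y i j) x (Wf (2*m+1) x k)
      = Rf m x i * Tf m x j * (Ff m x k (2*(i/2)) - Ff m x k (bIdx m j)) := by
  have hb : bIdx m j ≤ 2*m-1 := by unfold bIdx; split_ifs <;> omega
  have e : fderiv ℝ (fun y => pi1 (2*m+1) y i j) x
      = fderiv ℝ (fun y => ((-1:ℝ)^i * wt m j) *
          (altC (2*m+1) y (bIdx m j) / altC (2*m+1) y (2*(i/2)))) x := by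
    apply Filter.EventuallyEq.fderiv_eq
    have : ∀ᶠ y in nhds x, ∀ i, y i ≠ 0 :=
      Filter.eventually_all.2 fun i => (continuous_apply i).continuousAt.eventually_ne (hx i)
    filter_upwards [this] with y hy
    rw [pi1_eq m hy i j hi him hij hj]
    unfold Rf Tf
    ring
  have h0 := altC_ne hx (2*(i/2)) (by omega)
  have d1 := altC_diff hx (2*(i/2)) (by omega)
  have d2 := altC_diff hx (bIdx m j) (by omega)
  rw [e, fderiv_mul_W (by fun_prop) (diff_div d2 d1 h0), fderiv_div_W d2 d1 h0,
    altC_fderiv m hx k hk hk2 _ hb, altC_fderiv m hx k hk hk2 _ (by omega)]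
  simp only [fderiv_fun_const]
  unfold Rf Tf
  simp
  field_simp
  ring

/-- the Jacobiator -/
noncomputable def Jac (m : ℕ) (x : Fin (2*m+1) → ℝ) (i j k : ℕ) : ℝ :=
  fderiv ℝ (fun y => pi1 (2*m+1) y j k) x (Wf (2*m+1) x i)
  + fderiv ℝ (fun y => pi1 (2*m+1) y k i) x (Wf (2*m+1) x j)
  + fderiv ℝ (fun y => pi1 (2*m+1) y i j) x (Wf (2*m+1) x k)

lemma fderiv_skew (n : ℕ) (x W : Fin n → ℝ) (i j : ℕ) :
    fderiv ℝ (fun y => pi1 n y i j) x W = - fderiv ℝ (fun y => pi1 n y j i) x W := by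
  have : (fun y => pi1 n y i j) = fun y => - pi1 n y j i := by
    funext y; exact pi1_skew n y i j
  rw [this, fderiv_fun_neg]; simp

lemma Jac_cyc (m : ℕ) (x : Fin (2*m+1) → ℝ) (i j k : ℕ) : Jac m x i j k = Jac m x j k i := by
  unfold Jac; ring

lemma Jac_swap (m : ℕ) (x : Fin (2*m+1) → ℝ) (i j k : ℕ) : Jac m x i j k = - Jac m x j i k := by
  unfold Jac
  rw [fderiv_skew _ _ _ j k, fderiv_skew _ _ _ k i, fderiv_skew _ _ _ i j]; ring

lemma Jac_lt_main (m : ℕ) {x : Fin (2*m+1) → ℝ} (hx : ∀ i, x i ≠ 0) (i j k : ℕ)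
    (hi : 1 ≤ i) (hij : i < j) (hjk : j < k) (hk : k ≤ 2*m+1) (hj : j ≤ 2*m-1) :
    Jac m x i j k = 0 := by
  unfold Jac
  rw [fderiv_skew _ _ _ k i, pi1_fderiv m hx j k i hi (by omega) (by omega) hj hjk hk,
    pi1_fderiv m hx i k j (by omega) (by omega) hi (by omega) (by omega) hk,
    pi1_fderiv m hx i j k (by omega) hk hi (by omega) hij (by omega)]
  have hbj : bIdx m j = 2*((j+1)/2)-1 := by unfold bIdx; rw [if_neg (by omega)]
  have hbk : j ≤ bIdx m k := by unfold bIdx; split_ifs <;> omega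
  unfold Ff
  rw [if_neg (show ¬ 2*(j/2) < i by omega), if_neg (show ¬ bIdx m k < i by omega),
    if_pos (show 2*(i/2) < j by omega), if_neg (show ¬ bIdx m k < j by omega),
    if_pos (show 2*(i/2) < k by omega), if_pos (show bIdx m j < k by omega)]
  suffices hs : Tf m x j * (SP m x (j-1) - SP m x (bIdx m j))
      + Rf m x j * (SQ m x (2*(j/2)) - SQ m x j) = 0 by
    linear_combination (Rf m x i * Tf m x k) * hs
  rcases Nat.even_or_odd' j with ⟨a, rfl | rfl⟩
  · rw [hbj, show 2*((2*a+1)/2)-1 = 2*a-1 by omega, show 2*(2*a/2) = 2*a by omega]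
    ring
  · have h1 := altC_ne hx (2*a) (by omega)
    have h2 := altC_ne hx (2*a+1) (by omega)
    rw [hbj, show 2*((2*a+1+1)/2)-1 = 2*a+1 by omega, show 2*((2*a+1)/2) = 2*a by omega,
      show 2*a+1-1 = 2*a by omega]
    have e1 : SP m x (2*a+1) = SP m x (2*a) + pf m x (2*a+1) := by
      simp [SP, Finset.sum_range_succ]
    have e2 : SQ m x (2*a+1) = SQ m x (2*a) + qf m x (2*a+1) := by
      simp [SQ, Finset.sum_range_succ]
    rw [e1, e2]
    unfold Tf Rf pf qf wt
    rw [if_pos hj, hbj, show 2*((2*a+1+1)/2)-1 = 2*a+1 by omega,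
      show 2*((2*a+1)/2) = 2*a by omega]
    field_simp
    ring

lemma Jac_lt_last (m : ℕ) {x : Fin (2*m+1) → ℝ} (hx : ∀ i, x i ≠ 0) (i : ℕ)
    (hi : 1 ≤ i) (hij : i < 2*m) : Jac m x i (2*m) (2*m+1) = 0 := by
  have hbb : bIdx m (2*m) = bIdx m (2*m+1) := by
    unfold bIdx; rw [if_neg (by omega), if_pos rfl]; omega
  have hT : Tf m x (2*m) = Tf m x (2*m+1) := by
    unfold Tf wt
    rw [if_neg (by omega), if_neg (by omega), hbb]
  have hb : bIdx m (2*m+1) = 2*m-1 := by unfold bIdx; rw [if_pos rfl]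
  have hlast : fderiv ℝ (fun y => pi1 (2*m+1) y (2*m) (2*m+1)) x (Wf (2*m+1) x i) = 0 := by
    have : (fun y => pi1 (2*m+1) y (2*m) (2*m+1)) =
        fun y => (1/2:ℝ) * (coord (2*m+1) y (2*m+1) - coord (2*m+1) y (2*m)) := by
      funext y
      unfold pi1 pi1B
      rw [if_pos (by omega), if_neg (by omega), if_neg (by omega), if_pos (by omega)]
      simp
    have d1 := (coord_hasFDerivAt_s6 (2*m+1) x (2*m+1) (by omega) (by omega)).differentiableAt
    have d2 := (coord_hasFDerivAt_s6 (2*m+1) x (2*m) (by omega) (by omega)).differentiableAt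
    rw [this, fderiv_mul_W (differentiableAt_const _) (d1.fun_sub d2), fderiv_fun_sub d1 d2]
    have c1 := coord_fderiv (2*m+1) x (2*m+1) i (by omega) (by omega)
    have c2 := coord_fderiv (2*m+1) x (2*m) i (by omega) (by omega)
    rw [ContinuousLinearMap.sub_apply, c1, c2, pi1_skew, pi1_skew _ _ (2*m) i,
      pi1_eq m hx i (2*m+1) hi (by omega) (by omega) (by omega),
      pi1_eq m hx i (2*m) hi (by omega) (by omega) (by omega), hT]
    simp
  unfold Jac
  rw [hlast, fderiv_skew _ _ _ (2*m+1) i,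
    pi1_fderiv m hx i (2*m+1) (2*m) (by omega) (by omega) hi (by omega) (by omega) (by omega),
    pi1_fderiv m hx i (2*m) (2*m+1) (by omega) (by omega) hi (by omega) (by omega) (by omega)]
  rw [hbb, hb, hT]
  unfold Ff
  rw [if_pos (by omega), if_pos (by omega), if_pos (by omega), if_pos (by omega), hT]
  ring

lemma Jac_lt (m : ℕ) {x : Fin (2*m+1) → ℝ} (hx : ∀ i, x i ≠ 0) (i j k : ℕ)
    (hi : 1 ≤ i) (hij : i < j) (hjk : j < k) (hk : k ≤ 2*m+1) :
    Jac m x i j k = 0 := by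
  by_cases hj : j ≤ 2*m-1
  · exact Jac_lt_main m hx i j k hi hij hjk hk hj
  · obtain rfl : j = 2*m := by omega
    obtain rfl : k = 2*m+1 := by omega
    exact Jac_lt_last m hx i hi hij

lemma Jac_eq (m : ℕ) (x : Fin (2*m+1) → ℝ) (i k : ℕ) : Jac m x i i k = 0 := by
  have := Jac_swap m x i i k
  linarith

lemma Jac_zero (m : ℕ) {x : Fin (2*m+1) → ℝ} (hx : ∀ i, x i ≠ 0) (i j k : ℕ)
    (hi1 : 1 ≤ i) (hi2 : i ≤ 2*m+1) (hj1 : 1 ≤ j) (hj2 : j ≤ 2*m+1)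
    (hk1 : 1 ≤ k) (hk2 : k ≤ 2*m+1) : Jac m x i j k = 0 := by
  have L := Jac_lt m hx
  rcases lt_trichotomy i j with h | h | h
  · rcases lt_trichotomy j k with h' | h' | h'
    · exact L _ _ _ hi1 h h' hk2
    · subst h'; rw [Jac_cyc]; exact Jac_eq _ _ _ _
    · rcases lt_trichotomy i k with h'' | h'' | h''
      · rw [Jac_cyc, Jac_swap, Jac_cyc, Jac_cyc, L _ _ _ hi1 h'' h' hj2, neg_zero]
      · subst h''; rw [Jac_cyc, Jac_cyc]; exact Jac_eq _ _ _ _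
      · rw [Jac_cyc, Jac_cyc]; exact L _ _ _ hk1 h'' h hj2
  · subst h; exact Jac_eq _ _ _ _
  · rw [Jac_swap, neg_eq_zero]
    rcases lt_trichotomy i k with h' | h' | h'
    · exact L _ _ _ hj1 h h' hk2
    · subst h'; rw [Jac_cyc]; exact Jac_eq _ _ _ _
    · rcases lt_trichotomy j k with h'' | h'' | h''
      · rw [Jac_cyc, Jac_swap, Jac_cyc, Jac_cyc, L _ _ _ hj1 h'' h' hi2, neg_zero]
      · subst h''; rw [Jac_cyc, Jac_cyc]; exact Jac_eq _ _ _ _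
      · rw [Jac_cyc, Jac_cyc]; exact L _ _ _ hk1 h'' h hi2

lemma sum_fderiv_s6 (n : ℕ) (x W : Fin n → ℝ) (f : (Fin n → ℝ) → ℝ) :
    ∑ l : Fin n, W l * fderiv ℝ f x (Pi.single l 1) = fderiv ℝ f x W := by
  conv_rhs => rw [pi_eq_sum_univ' W, map_sum]
  refine Finset.sum_congr rfl fun l _ => ?_
  rw [map_smul, smul_eq_mul]

/-- for odd `n = 2m+1 ≥ 5`, the tensor `π₁` is Poisson on the open set where all
coordinates are nonzero: it satisfies the Jacobi identity
`Σ_l (π_{li} ∂π_{jk}/∂v_l + π_{lj} ∂π_{ki}/∂v_l + π_{lk} ∂π_{ij}/∂v_l) = 0`. -/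
theorem pi1_is_poisson (m : ℕ) (hm : 2 ≤ m) (x : Fin (2*m+1) → ℝ)
    (hx : ∀ i, x i ≠ 0)
    (i j k : ℕ) (hi1 : 1 ≤ i) (hi2 : i ≤ 2*m+1) (hj1 : 1 ≤ j) (hj2 : j ≤ 2*m+1)
    (hk1 : 1 ≤ k) (hk2 : k ≤ 2*m+1) :
    ∑ l : Fin (2*m+1),
      (pi1 (2*m+1) x ((l : ℕ) + 1) i *
          fderiv ℝ (fun y => pi1 (2*m+1) y j k) x (Pi.single l 1)
        + pi1 (2*m+1) x ((l : ℕ) + 1) j *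
          fderiv ℝ (fun y => pi1 (2*m+1) y k i) x (Pi.single l 1)
        + pi1 (2*m+1) x ((l : ℕ) + 1) k *
          fderiv ℝ (fun y => pi1 (2*m+1) y i j) x (Pi.single l 1)) = 0 := by
  simp only [Finset.sum_add_distrib]
  have e := fun a (f : (Fin (2*m+1) → ℝ) → ℝ) => sum_fderiv_s6 (2*m+1) x (Wf (2*m+1) x a) f
  simp only [Wf] at e
  rw [e, e, e]
  exact Jac_zero m hx i j k hi1 hi2 hj1 hj2 hk1 hk2
end

section
/- Fix odd n = 2m+1 ≥ 5 and let π_1 be the rational Poisson matrix on {v ∈ ℝ^n : v_i ≠ 0 for all i} determined by τ_{ii} = v_{2i−1}, τ_{ij} = −τ_{ji} = v_{2i−1} Π_{k=i}^{j−1}(v_{2k+1}/v_{2k}) for i < j, and the brackets {v_i,v_j} = (−1)^{i+j−1} τ_{⌊i/2⌋+1,⌊(j+1)/2⌋} for 1 ≤ i < j ≤ n−2, {v_i,v_{n−1}} = {v_i,v_n} = ((−1)^{i+n}/2) τ_{⌊i/2⌋+1,⌊n/2⌋} for i = 1,…,n−2, {v_{n−1},v_n} = (1/2)(v_n − v_{n−1}).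 Let G(v) = v_{n−2}v_n + 2v_{n−1}v_n + Σ_{i=1}^{n−2} v_i v_{i+1} + (1/2) Σ_{i=2}^{n−2} v_i². Then for every v in this open set, the vector π_1(v)·∇G(v) equals the right-hand side of the Bogoyavlensky–Volterra D_{n+1} system, i.e. its components are v_1(v_1+v_2); v_k(v_{k+1}−v_{k−1}) for 2 ≤ k ≤ n−3; v_{n−2}(v_n+v_{n−1}−v_{n−3}); v_{n−1}(v_n−v_{n−1}−v_{n−2}); −v_n(v_n−v_{n−1}+v_{n−2}). -/
/-- The Hamiltonian
`G = v_{n-2}v_n + 2v_{n-1}v_n + Σ_{i=1}^{n-2} v_i v_{i+1} + (1/2)Σ_{i=2}^{n-2} v_i²`. -/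
noncomputable def Gfun (n : ℕ) (x : Fin n → ℝ) : ℝ :=
  coord n x (n-2) * coord n x n + 2 * coord n x (n-1) * coord n x n
    + ∑ i ∈ Finset.Icc 1 (n-2), coord n x i * coord n x (i+1)
    + (1/2) * ∑ i ∈ Finset.Icc 2 (n-2), (coord n x i)^2

/-- The right-hand side of the Bogoyavlensky–Volterra `D_{n+1}` system (1-based index `k`). -/
noncomputable def bvRHS (n : ℕ) (x : Fin n → ℝ) (k : ℕ) : ℝ :=
  if k = 1 then coord n x 1 * (coord n x 1 + coord n x 2)
  else if 2 ≤ k ∧ k ≤ n - 3 then coord n x k * (coord n x (k+1) - coord n x (k-1))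
  else if k = n - 2 then coord n x (n-2) * (coord n x n + coord n x (n-1) - coord n x (n-3))
  else if k = n - 1 then coord n x (n-1) * (coord n x n - coord n x (n-1) - coord n x (n-2))
  else -(coord n x n) * (coord n x n - coord n x (n-1) + coord n x (n-2))

lemma bv_neg_one_even (a : ℕ) : (-1 : ℝ)^(2*a) = 1 := by simp [pow_mul]

lemma bv_neg_one_odd (a : ℕ) : (-1 : ℝ)^(2*a+1) = -1 := by simp [pow_succ, pow_mul]

/-- abstract tau -/
noncomputable def bvT (w : ℕ → ℝ) (i j : ℕ) : ℝ :=
  w (2*i - 1) * ∏ k ∈ Finset.Ico i j, (w (2*k + 1) / w (2*k))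

/-- abstract bracket -/
noncomputable def bvP (w : ℕ → ℝ) (i j : ℕ) : ℝ :=
  if i < j then (-1 : ℝ)^(i + j + 1) * bvT w (i/2 + 1) ((j+1)/2)
  else if j < i then (-1 : ℝ)^(i + j) * bvT w (j/2 + 1) ((i+1)/2) else 0

/-- abstract gradient -/
noncomputable def bvH (w : ℕ → ℝ) (j : ℕ) : ℝ :=
  if j = 1 then w 2 else w (j-1) + w j + w (j+1)

lemma bvT_self (w : ℕ → ℝ) (i : ℕ) : bvT w i i = w (2*i-1) := by simp [bvT]

lemma bvT_top (w : ℕ → ℝ) (m a b : ℕ) (hab : a ≤ b) (hb : 1 ≤ b) (hbm : b ≤ m)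
    (hw : ∀ i, 1 ≤ i → i < 2*m → w i ≠ 0) (h0 : w (2*m+1) = 0) :
    bvT w a (b+1) * w (2*b) = bvT w a b * w (2*b+1) := by
  unfold bvT
  rw [Finset.prod_Ico_succ_top hab]
  rcases Nat.lt_or_ge b m with h | h
  · have := hw (2*b) (by omega) (by omega)
    field_simp
  · obtain rfl : b = m := le_antisymm hbm h
    simp [h0]

lemma bvT_bot (w : ℕ → ℝ) (m b d : ℕ) (hbd : b < d) (hb : 1 ≤ b) (hbm : b < m)
    (hw : ∀ i, 1 ≤ i → i < 2*m → w i ≠ 0) :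
    bvT w b d * w (2*b) = w (2*b-1) * bvT w (b+1) d := by
  unfold bvT
  rw [Finset.prod_eq_prod_Ico_succ_bot hbd]
  have := hw (2*b) (by omega) (by omega)
  rw [show 2*(b+1)-1 = 2*b+1 by omega]
  field_simp

lemma bv_up (w : ℕ → ℝ) (m a B M : ℕ) (hB : 1 ≤ B) (haB : a ≤ B+1) (hBM : B ≤ M)
    (hw : ∀ i, 1 ≤ i → i < 2*m → w i ≠ 0) (h0 : w (2*m+1) = 0) : M ≤ m →
    ∑ j ∈ Finset.Ico (2*B+1) (2*M+1), (-1 : ℝ)^(j+1) * bvT w a ((j+1)/2) * bvH w j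
      = bvT w a (B+1) * w (2*B) - bvT w a (M+1) * w (2*M) := by
  induction M, hBM using Nat.le_induction with
  | base => simp
  | succ M hM ih =>
    intro hMm
    rw [show 2*(M+1)+1 = 2*M+1+1+1 by ring, Finset.sum_Ico_succ_top (by omega),
      Finset.sum_Ico_succ_top (by omega), ih (by omega)]
    have key := bvT_top w m a (M+1) (by omega) (by omega) hMm hw h0
    rw [show (2*M+1+1)/2 = M+1 by omega, show (2*M+1+1+1)/2 = M+1 by omega,
      show 2*M+1+1 = 2*(M+1) by ring, bv_neg_one_even, bv_neg_one_odd, key]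
    unfold bvH
    rw [if_neg (by omega), if_neg (by omega), show 2*(M+1)-1 = 2*M+1 by omega,
      show 2*M+1-1 = 2*M by omega, show 2*M+1+1 = 2*(M+1) by ring]
    ring

lemma bv_low (w : ℕ → ℝ) (m d E : ℕ) (hE : 1 ≤ E)
    (hw : ∀ i, 1 ≤ i → i < 2*m → w i ≠ 0) : E ≤ d → E ≤ m →
    ∑ j ∈ Finset.Ico 1 (2*E), (-1 : ℝ)^j * bvT w (j/2+1) d * bvH w j
      = - bvT w E d * w (2*E) := by
  induction E, hE using Nat.le_induction with
  | base => simp [bvH]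
  | succ E hE ih =>
    intro hd hm
    rw [show 2*(E+1) = 2*E+1+1 by ring, Finset.sum_Ico_succ_top (by omega),
      Finset.sum_Ico_succ_top (by omega), ih (by omega) (by omega)]
    have key := bvT_bot w m E d (by omega) hE (by omega) hw
    rw [show (2*E+1)/2 = E by omega, show (2*E)/2 = E by omega, bv_neg_one_even, bv_neg_one_odd,
      neg_mul, key]
    unfold bvH
    rw [if_neg (by omega), if_neg (by omega), show 2*E+1-1 = 2*E by omega]
    ring

lemma bv_split (w : ℕ → ℝ) (m k : ℕ) (hk : 1 ≤ k) (hkm : k ≤ 2*m) :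
    ∑ j ∈ Finset.Ico 1 (2*m+1), bvP w k j * bvH w j
     = (-1:ℝ)^k * ∑ j ∈ Finset.Ico 1 k, (-1 : ℝ)^j * bvT w (j/2+1) ((k+1)/2) * bvH w j
     + (-1:ℝ)^k * ∑ j ∈ Finset.Ico (k+1) (2*m+1),
        (-1 : ℝ)^(j+1) * bvT w (k/2+1) ((j+1)/2) * bvH w j := by
  rw [← Finset.sum_Ico_consecutive _ hk (show k ≤ 2*m+1 by omega),
    Finset.sum_eq_sum_Ico_succ_bot (show k < 2*m+1 by omega), Finset.mul_sum, Finset.mul_sum]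
  have : bvP w k k = 0 := by simp [bvP]
  rw [this, zero_mul, zero_add]
  congr 1
  · refine Finset.sum_congr rfl fun j hj => ?_
    rw [Finset.mem_Ico] at hj
    rw [bvP, if_neg (by omega), if_pos hj.2, pow_add]; ring
  · refine Finset.sum_congr rfl fun j hj => ?_
    rw [Finset.mem_Ico] at hj
    rw [bvP, if_pos (by omega), add_assoc, pow_add]; ring

lemma bv_main (w : ℕ → ℝ) (m k : ℕ) (hk : 1 ≤ k) (hkm : k ≤ 2*m)
    (hw : ∀ i, 1 ≤ i → i < 2*m → w i ≠ 0) (h0 : w (2*m+1) = 0) :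
    ∑ j ∈ Finset.Ico 1 (2*m+1), bvP w k j * bvH w j
     = if k = 1 then w 1 * (w 1 + w 2) else w k * (w (k+1) - w (k-1)) := by
  rw [bv_split w m k hk hkm]
  have hlast : ∀ a, a ≤ m → bvT w a (m+1) * w (2*m) = 0 := fun a ha => by
    rw [bvT_top w m a m ha (by omega) le_rfl hw h0, h0, mul_zero]
  rcases Nat.even_or_odd' k with ⟨c, rfl | rfl⟩
  · rw [if_neg (by omega), bv_neg_one_even, show (2*c+1)/2 = c by omega,
      show 2*c/2 = c by omega, bv_low w m c c (by omega) hw le_rfl (by omega),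
      bv_up w m (c+1) c m (by omega) le_rfl (by omega) hw h0 le_rfl, bvT_self, bvT_self,
      show 2*(c+1)-1 = 2*c+1 by omega]
    have : bvT w (c+1) (m+1) * w (2*m) = 0 := by
      rcases Nat.lt_or_ge c m with h | h
      · exact hlast _ h
      · obtain rfl : c = m := by omega
        rw [bvT_self, show 2*(c+1)-1 = 2*c+1 by omega, h0, zero_mul]
    rw [this]; ring
  · rw [bv_neg_one_odd, show (2*c+1+1)/2 = c+1 by omega, show (2*c+1)/2 = c by omega,
      Finset.sum_eq_sum_Ico_succ_bot (show 2*c+1+1 < 2*m+1 by omega)]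
    rw [show 2*c+1+1 = 2*(c+1) by ring,
      bv_up w m (c+1) (c+1) m (by omega) (by omega) (by omega) hw h0 le_rfl,
      hlast _ (by omega), bv_neg_one_odd, bvT_top w m (c+1) (c+1) le_rfl (by omega) (by omega) hw h0,
      show (2*(c+1)+1)/2 = c+1 by omega, bvT_self, show 2*(c+1)-1 = 2*c+1 by omega]
    have hH : bvH w (2*(c+1)) = w (2*c+1) + w (2*(c+1)) + w (2*(c+1)+1) := by
      rw [bvH, if_neg (by omega), show 2*(c+1)-1 = 2*c+1 by omega]
    rw [hH]
    rcases Nat.eq_zero_or_pos c with rfl | hc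
    · simp; ring
    · rw [if_neg (by omega), Finset.sum_Ico_succ_top (by omega),
        bv_low w m (c+1) c hc hw (by omega) (by omega), bv_neg_one_even, neg_mul (bvT w c (c+1)),
        bvT_bot w m c (c+1) (by omega) hc (by omega) hw, show 2*c/2 = c by omega, bvT_self,
        show 2*(c+1)-1 = 2*c+1 by omega, bvH, if_neg (by omega), show 2*c+1-1 = 2*c by omega]
      ring

/-- coordinate as a continuous linear map -/
noncomputable def bvL (n i : ℕ) : (Fin n → ℝ) →L[ℝ] ℝ :=
  if h : 1 ≤ i ∧ i ≤ n then ContinuousLinearMap.proj (⟨i - 1, by omega⟩ : Fin n) else 0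

lemma bvL_apply (n i : ℕ) (x : Fin n → ℝ) : bvL n i x = coord n x i := by
  unfold bvL coord
  split_ifs <;> simp

lemma bv_coord_single (n i : ℕ) (l : Fin n) :
    coord n (Pi.single l 1) i = if i = (l : ℕ) + 1 then 1 else 0 := by
  unfold coord
  have := l.2
  by_cases h : 1 ≤ i ∧ i ≤ n
  · rw [dif_pos h, Pi.single_apply]
    congr 1
    rw [Fin.ext_iff]
    simp only [eq_iff_iff]
    omega
  · rw [dif_neg h, if_neg (by omega)]

lemma bv_hasF (n i : ℕ) (x : Fin n → ℝ) :
    HasFDerivAt (fun y => coord n y i) (bvL n i) x := by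
  have : (fun y => coord n y i) = bvL n i := by ext y; rw [bvL_apply]
  rw [this]; exact (bvL n i).hasFDerivAt

lemma bv_fderiv (n : ℕ) (x e : Fin n → ℝ) : fderiv ℝ (Gfun n) x e =
    coord n x (n-2) * coord n e n + coord n e (n-2) * coord n x n
    + 2 * (coord n x (n-1) * coord n e n + coord n e (n-1) * coord n x n)
    + ∑ i ∈ Finset.Icc 1 (n-2), (coord n x i * coord n e (i+1) + coord n e i * coord n x (i+1))
    + ∑ i ∈ Finset.Icc 2 (n-2), coord n x i * coord n e i := by
  have h : HasFDerivAt (Gfun n) _ x :=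
    ((((bv_hasF n (n-2) x).mul (bv_hasF n n x)).add
      (((bv_hasF n (n-1) x).const_mul 2).mul (bv_hasF n n x))).add
      (HasFDerivAt.fun_sum (u := Finset.Icc 1 (n-2)) fun i _ =>
        (bv_hasF n i x).mul (bv_hasF n (i+1) x))).add
      ((HasFDerivAt.fun_sum (u := Finset.Icc 2 (n-2)) fun i _ =>
        (bv_hasF n i x).pow 2).const_mul (1/2))
  rw [h.fderiv]
  simp only [add_apply, smul_apply, bvL_apply,
    sum_apply, smul_eq_mul, Finset.mul_sum]
  congr 1
  · congr 1
    · ring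
    · refine Finset.sum_congr rfl fun i _ => by ring
  · refine Finset.sum_congr rfl fun i _ => ?_
    simp
    ring

/-- gradient of G -/
noncomputable def bvG (m : ℕ) (v : ℕ → ℝ) (j : ℕ) : ℝ :=
  if j = 2*m+1 then v (2*m-1) + 2 * v (2*m)
  else if j = 2*m then v (2*m-1) + 2 * v (2*m+1)
  else if j = 2*m-1 then v (2*m-2) + v (2*m-1) + (v (2*m) + v (2*m+1))
  else if j = 1 then v 2
  else v (j-1) + v j + v (j+1)

lemma bv_grad (m : ℕ) (hm : 2 ≤ m) (x : Fin (2*m+1) → ℝ) (l : Fin (2*m+1)) (j : ℕ)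
    (hj : j = (l : ℕ) + 1) :
    fderiv ℝ (Gfun (2*m+1)) x (Pi.single l 1) =
      bvG m (coord (2*m+1) x) j := by
  have hl := l.2
  rw [bv_fderiv, bvG]
  simp only [bv_coord_single, ← hj, show 2*m+1-2 = 2*m-1 by omega, show 2*m+1-1 = 2*m by omega]
  generalize coord (2*m+1) x = v
  obtain ⟨q, rfl⟩ : ∃ q, j = q + 1 := ⟨l, hj⟩
  simp only [Finset.sum_add_distrib, mul_ite, ite_mul, mul_one, mul_zero, one_mul, zero_mul,
    Nat.add_right_cancel_iff, Finset.sum_ite_eq', Finset.mem_Icc]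
  by_cases h1 : q = 2*m
  · have e0 : (2*m = q) = True := eq_true (by omega)
    have e1 : (q = 2*m) = True := eq_true (by omega)
    have e2 : (2*m-1 = q+1) = False := eq_false (by omega)
    have e3 : (2*m = q+1) = False := eq_false (by omega)
    have e4 : (1 ≤ q ∧ q ≤ 2*m-1) = False := eq_false (by omega)
    have e5 : (1 ≤ q+1 ∧ q+1 ≤ 2*m-1) = False := eq_false (by omega)
    have e6 : (2 ≤ q+1 ∧ q+1 ≤ 2*m-1) = False := eq_false (by omega)
    have e7 : (q+1 = 2*m) = False := eq_false (by omega)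
    have e8 : (q+1 = 2*m-1) = False := eq_false (by omega)
    have e9 : (q+1 = 1) = False := eq_false (by omega)
    have e10 : (q = 0) = False := eq_false (by omega)
    simp only [e0, e1, e2, e3, e4, e5, e6, e7, e8, e9, e10, if_true, if_false]
    ring
  by_cases h2 : q + 1 = 2*m
  · have e0 : (2*m = q) = False := eq_false (by omega)
    have e1 : (q = 2*m) = False := eq_false (by omega)
    have e2 : (2*m-1 = q+1) = False := eq_false (by omega)
    have e3 : (2*m = q+1) = True := eq_true (by omega)
    have e4 : (1 ≤ q ∧ q ≤ 2*m-1) = True := eq_true (by omega)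
    have e5 : (1 ≤ q+1 ∧ q+1 ≤ 2*m-1) = False := eq_false (by omega)
    have e6 : (2 ≤ q+1 ∧ q+1 ≤ 2*m-1) = False := eq_false (by omega)
    have e7 : (q+1 = 2*m) = True := eq_true (by omega)
    have e8 : (q+1 = 2*m-1) = False := eq_false (by omega)
    have e9 : (q+1 = 1) = False := eq_false (by omega)
    have e10 : (q = 0) = False := eq_false (by omega)
    simp only [e0, e1, e2, e3, e4, e5, e6, e7, e8, e9, e10, if_true, if_false]
    rw [show q = 2*m-1 by omega]
    ring
  by_cases h3 : q + 1 = 2*m-1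
  · have e0 : (2*m = q) = False := eq_false (by omega)
    have e1 : (q = 2*m) = False := eq_false (by omega)
    have e2 : (2*m-1 = q+1) = True := eq_true (by omega)
    have e3 : (2*m = q+1) = False := eq_false (by omega)
    have e4 : (1 ≤ q ∧ q ≤ 2*m-1) = True := eq_true (by omega)
    have e5 : (1 ≤ q+1 ∧ q+1 ≤ 2*m-1) = True := eq_true (by omega)
    have e6 : (2 ≤ q+1 ∧ q+1 ≤ 2*m-1) = True := eq_true (by omega)
    have e7 : (q+1 = 2*m) = False := eq_false (by omega)
    have e8 : (q+1 = 2*m-1) = True := eq_true (by omega)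
    have e9 : (q+1 = 1) = False := eq_false (by omega)
    have e10 : (q = 0) = False := eq_false (by omega)
    simp only [e0, e1, e2, e3, e4, e5, e6, e7, e8, e9, e10, if_true, if_false]
    rw [show q = 2*m-2 by omega, show 2*m-2+1 = 2*m-1 by omega, show 2*m-1+1 = 2*m by omega]
    ring
  by_cases h4 : q = 0
  · have e0 : (2*m = q) = False := eq_false (by omega)
    have e1 : (q = 2*m) = False := eq_false (by omega)
    have e2 : (2*m-1 = q+1) = False := eq_false (by omega)
    have e3 : (2*m = q+1) = False := eq_false (by omega)
    have e4 : (1 ≤ q ∧ q ≤ 2*m-1) = False := eq_false (by omega)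
    have e5 : (1 ≤ q+1 ∧ q+1 ≤ 2*m-1) = True := eq_true (by omega)
    have e6 : (2 ≤ q+1 ∧ q+1 ≤ 2*m-1) = False := eq_false (by omega)
    have e7 : (q+1 = 2*m) = False := eq_false (by omega)
    have e8 : (q+1 = 2*m-1) = False := eq_false (by omega)
    have e9 : (q+1 = 1) = True := eq_true (by omega)
    have e10 : (q = 0) = True := eq_true (by omega)
    simp only [e0, e1, e2, e3, e4, e5, e6, e7, e8, e9, e10, if_true, if_false]
    subst h4
    ring
  have e0 : (2*m = q) = False := eq_false (by omega)
  have e1 : (q = 2*m) = False := eq_false (by omega)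
  have e2 : (2*m-1 = q+1) = False := eq_false (by omega)
  have e3 : (2*m = q+1) = False := eq_false (by omega)
  have e4 : (1 ≤ q ∧ q ≤ 2*m-1) = True := eq_true (by omega)
  have e5 : (1 ≤ q+1 ∧ q+1 ≤ 2*m-1) = True := eq_true (by omega)
  have e6 : (2 ≤ q+1 ∧ q+1 ≤ 2*m-1) = True := eq_true (by omega)
  have e7 : (q+1 = 2*m) = False := eq_false (by omega)
  have e8 : (q+1 = 2*m-1) = False := eq_false (by omega)
  have e9 : (q+1 = 1) = False := eq_false (by omega)
  have e10 : (q = 0) = False := eq_false (by omega)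
  simp only [e0, e1, e2, e3, e4, e5, e6, e7, e8, e9, e10, if_true, if_false]
  rw [Nat.add_sub_cancel]
  ring

/-- the reduced sequence -/
noncomputable def bvW (m : ℕ) (v : ℕ → ℝ) (i : ℕ) : ℝ :=
  if i < 2*m then v i else if i = 2*m then v (2*m) + v (2*m+1) else 0

lemma bvW_lt (m : ℕ) (v : ℕ → ℝ) (i : ℕ) (h : i < 2*m) : bvW m v i = v i := if_pos h
lemma bvW_top (m : ℕ) (v : ℕ → ℝ) : bvW m v (2*m) = v (2*m) + v (2*m+1) := by simp [bvW]
lemma bvW_out (m : ℕ) (v : ℕ → ℝ) : bvW m v (2*m+1) = 0 := by simp [bvW]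

lemma bv_tau (m : ℕ) (x : Fin (2*m+1) → ℝ) (i j : ℕ) (hi : i ≤ m) (h1 : 1 ≤ i) (hj : j ≤ m) :
    tauD (2*m+1) x i j = bvT (bvW m (coord (2*m+1) x)) i j := by
  unfold tauD bvT
  rw [bvW_lt _ _ _ (by omega)]
  congr 1
  refine Finset.prod_congr rfl fun k hk => ?_
  rw [Finset.mem_Ico] at hk
  rw [bvW_lt _ _ _ (by omega), bvW_lt _ _ _ (by omega)]

lemma bv_piB (m : ℕ) (x : Fin (2*m+1) → ℝ) (i j : ℕ) (h1 : 1 ≤ i) (hij : i < j)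
    (hj : j < 2*m) : pi1B (2*m+1) x i j =
      (-1 : ℝ)^(i + j + 1) * bvT (bvW m (coord (2*m+1) x)) (i/2+1) ((j+1)/2) := by
  rw [pi1B, if_pos (by omega), bv_tau _ _ _ _ (by omega) (by omega) (by omega),
    show i + j + 1 = (i + j - 1) + 2 by omega, pow_add]
  simp

lemma bv_piB_top (m : ℕ) (x : Fin (2*m+1) → ℝ) (i j : ℕ) (h1 : 1 ≤ i) (hi : i < 2*m)
    (hj : j = 2*m ∨ j = 2*m+1) : pi1B (2*m+1) x i j =
      (1/2) * ((-1 : ℝ)^(i + 2*m + 1) * bvT (bvW m (coord (2*m+1) x)) (i/2+1) ((2*m+1)/2)) := by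
  rw [pi1B, if_neg (by omega), if_pos (by omega), bv_tau _ _ _ _ (by omega) (by omega) (by omega),
    add_assoc i]
  ring

lemma bv_pi (m : ℕ) (x : Fin (2*m+1) → ℝ) (i j : ℕ) (h1 : 1 ≤ i) (hi : i < 2*m) (h2 : 1 ≤ j)
    (hj : j < 2*m) : pi1 (2*m+1) x i j = bvP (bvW m (coord (2*m+1) x)) i j := by
  unfold pi1 bvP
  split_ifs with h h'
  · exact bv_piB m x i j h1 h hj
  · rw [bv_piB m x j i h2 h' hi, add_comm j i, pow_succ]; ring
  · rfl

lemma bv_pi_top (m : ℕ) (x : Fin (2*m+1) → ℝ) (i j : ℕ) (h1 : 1 ≤ i) (hi : i < 2*m)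
    (hj : j = 2*m ∨ j = 2*m+1) :
    pi1 (2*m+1) x i j = (1/2) * bvP (bvW m (coord (2*m+1) x)) i (2*m) := by
  rw [pi1, if_pos (by omega), bvP, if_pos (by omega), bv_piB_top m x i j h1 hi hj]

lemma bv_pi_low (m : ℕ) (x : Fin (2*m+1) → ℝ) (i j : ℕ) (h1 : 1 ≤ j) (hi : j < 2*m)
    (hj : i = 2*m ∨ i = 2*m+1) :
    pi1 (2*m+1) x i j = (1/2) * bvP (bvW m (coord (2*m+1) x)) (2*m) j := by
  rw [pi1, if_neg (by omega), if_pos (by omega), bvP, if_neg (by omega), if_pos (by omega),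
    bv_piB_top m x j i h1 hi hj, add_comm j, pow_succ]
  ring

lemma bv_gradH (m : ℕ) (hm : 2 ≤ m) (v : ℕ → ℝ) (j : ℕ) (hjm : j < 2*m) :
    bvG m v j = bvH (bvW m v) j := by
  rw [bvG, if_neg (by omega), if_neg (by omega), bvH]
  split_ifs with h h' h'
  · omega
  · rw [h, bvW_lt _ _ _ (by omega), bvW_lt _ _ _ (by omega), show 2*m-1+1 = 2*m by omega, bvW_top,
      show 2*m-1-1 = 2*m-2 by omega]
  · rw [bvW_lt _ _ _ (by omega)]
  · rw [bvW_lt _ _ _ (by omega), bvW_lt _ _ _ (by omega), bvW_lt _ _ _ (by omega)]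

theorem pi1_gradG_is_BV (m : ℕ) (hm : 2 ≤ m) (x : Fin (2*m+1) → ℝ)
    (hx : ∀ i, x i ≠ 0) (k : ℕ) (hk1 : 1 ≤ k) (hk2 : k ≤ 2*m+1) :
    ∑ l : Fin (2*m+1),
        pi1 (2*m+1) x k ((l : ℕ) + 1) * fderiv ℝ (Gfun (2*m+1)) x (Pi.single l 1)
      = bvRHS (2*m+1) x k := by
  obtain ⟨v, hv⟩ : ∃ v, v = coord (2*m+1) x := ⟨_, rfl⟩
  obtain ⟨w, hwdef⟩ : ∃ w, w = bvW m v := ⟨_, rfl⟩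
  have hw : ∀ i, 1 ≤ i → i < 2*m → w i ≠ 0 := fun i h1 h2 => by
    rw [hwdef, bvW_lt _ _ _ h2, hv, coord, dif_pos ⟨h1, by omega⟩]
    exact hx _
  have h0 : w (2*m+1) = 0 := by rw [hwdef, bvW_out]
  have htop : w (2*m) = v (2*m) + v (2*m+1) := by rw [hwdef, bvW_top]
  have hlt : ∀ i, i < 2*m → w i = v i := fun i h => by rw [hwdef, bvW_lt _ _ _ h]
  have hHtop : bvH w (2*m) = v (2*m-1) + (v (2*m) + v (2*m+1)) := by
    rw [bvH, if_neg (by omega), h0, htop, hlt _ (by omega), add_zero]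
  have hgrad : ∀ l : Fin (2*m+1), pi1 (2*m+1) x k ((l : ℕ) + 1) *
      fderiv ℝ (Gfun (2*m+1)) x (Pi.single l 1)
      = (fun i : ℕ => pi1 (2*m+1) x k (i+1) * bvG m v (i+1)) l := fun l => by
    rw [bv_grad m hm x l _ rfl, hv]
  rw [Finset.sum_congr rfl (fun l _ => hgrad l),
    Fin.sum_univ_eq_sum_range (fun i : ℕ => pi1 (2*m+1) x k (i+1) * bvG m v (i+1)) (2*m+1),
    Finset.range_eq_Ico,
    Finset.sum_Ico_add' (fun i : ℕ => pi1 (2*m+1) x k i * bvG m v i) 0 (2*m+1) 1, zero_add,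
    Finset.sum_Ico_succ_top (by omega), Finset.sum_Ico_succ_top (by omega)]
  have hg1 : bvG m v (2*m) = v (2*m-1) + 2 * v (2*m+1) := by
    rw [bvG, if_neg (by omega), if_pos rfl]
  have hg2 : bvG m v (2*m+1) = v (2*m-1) + 2 * v (2*m) := by
    rw [bvG, if_pos rfl]
  rw [hg1, hg2]
  by_cases hk : k < 2*m
  · have hmain := bv_main w m k hk1 hk.le hw h0
    rw [Finset.sum_Ico_succ_top (by omega), hHtop] at hmain
    have hs : ∑ j ∈ Finset.Ico 1 (2*m), pi1 (2*m+1) x k j * bvG m v j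
        = ∑ j ∈ Finset.Ico 1 (2*m), bvP w k j * bvH w j := by
      refine Finset.sum_congr rfl fun j hj => ?_
      rw [Finset.mem_Ico] at hj
      rw [bv_gradH m hm v j hj.2, bv_pi m x k j hk1 hk hj.1 hj.2, ← hv, ← hwdef]
    have hR : bvRHS (2*m+1) x k
        = if k = 1 then w 1 * (w 1 + w 2) else w k * (w (k+1) - w (k-1)) := by
      rw [bvRHS, ← hv, hlt k hk, hlt 1 (by omega), hlt 2 (by omega), hlt (k-1) (by omega)]
      split_ifs with h1 h2 h3 h4
      · rfl
      · rw [hlt (k+1) (by omega)]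
      · obtain rfl : k = 2*m-1 := by omega
        rw [show 2*m-1+1 = 2*m by omega, htop, show 2*m+1-2 = 2*m-1 by omega,
          show 2*m+1-1 = 2*m by omega, show 2*m+1-3 = 2*m-1-1 by omega]
        ring
      · omega
      · omega
    rw [hs, hR, ← hmain, bv_pi_top m x k (2*m) hk1 hk (Or.inl rfl),
      bv_pi_top m x k (2*m+1) hk1 hk (Or.inr rfl), ← hv, ← hwdef]
    ring
  · have hmain := bv_main w m (2*m) (by omega) le_rfl hw h0
    have hPP : bvP w (2*m) (2*m) = 0 := by simp [bvP]
    rw [Finset.sum_Ico_succ_top (by omega), hPP, if_neg (by omega), h0, htop,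
      hlt (2*m-1) (by omega)] at hmain
    have hs : ∑ j ∈ Finset.Ico 1 (2*m), pi1 (2*m+1) x k j * bvG m v j
        = (1/2) * ∑ j ∈ Finset.Ico 1 (2*m), bvP w (2*m) j * bvH w j := by
      rw [Finset.mul_sum]
      refine Finset.sum_congr rfl fun j hj => ?_
      rw [Finset.mem_Ico] at hj
      rw [bv_gradH m hm v j hj.2, bv_pi_low m x k j hj.1 hj.2 (by omega), ← hv, ← hwdef, mul_assoc]
    have hB : pi1B (2*m+1) x (2*m) (2*m+1) = (1/2) * (v (2*m+1) - v (2*m)) := by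
      rw [pi1B, if_neg (by omega), if_neg (by omega), if_pos (by omega), ← hv,
        show 2*m+1-1 = 2*m by omega]
    rw [hs]
    rcases (by omega : k = 2*m ∨ k = 2*m+1) with rfl | rfl
    · have e1 : pi1 (2*m+1) x (2*m) (2*m) = 0 := by simp [pi1]
      have e2 : pi1 (2*m+1) x (2*m) (2*m+1) = (1/2) * (v (2*m+1) - v (2*m)) := by
        rw [pi1, if_pos (by omega), hB]
      rw [e1, e2, bvRHS, if_neg (by omega), if_neg (by omega), if_neg (by omega),
        if_pos (by omega), ← hv, show 2*m+1-2 = 2*m-1 by omega, show 2*m+1-1 = 2*m by omega]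
      linear_combination (1/2) * hmain
    · have e1 : pi1 (2*m+1) x (2*m+1) (2*m+1) = 0 := by simp [pi1]
      have e2 : pi1 (2*m+1) x (2*m+1) (2*m) = -((1/2) * (v (2*m+1) - v (2*m))) := by
        rw [pi1, if_neg (by omega), if_pos (by omega), hB]
      rw [e1, e2, bvRHS, if_neg (by omega), if_neg (by omega), if_neg (by omega),
        if_neg (by omega), ← hv, show 2*m+1-2 = 2*m-1 by omega, show 2*m+1-1 = 2*m by omega]
      linear_combination (1/2) * hmain
end
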